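/- arXiv:2510.27292 — 13 statements merged into one kernel-verified Lean document; each statement's English description precedes it below -/
import Mathlib

section
/- Assume k > 1. Then (0, 0) is an equilibrium of system (★), the vector field of (★) is differentiable at (0, 0), and its derivative there is the matrix [[Λ₀ − γ, 0], [η, −1]], whose eigenvalues are Λ₀ − γ and −1. Consequently, if R₀ < 1 (i.e., Λ₀ < γ) then both eigenvalues are negative and (0, 0) is locally asymptotically stable: there exists δ > 0 such that every solution of (★) defined on [0, ∞) with ‖(x(0), y(0))‖ < δ remains bounded near the origin and converges to (0, 0) as t → ∞; if R₀ > 1 the matrix has one positive and one negative eigenvalue. -/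
/-- The vector field of system (★):
`x' = x(1+p·x^(k−1))(Λ₀−x−y) − γx`, `y' = ηx − y` (real powers). -/
noncomputable def starVF (p Λ₀ γ η k : ℝ) (q : ℝ × ℝ) : ℝ × ℝ :=
  (q.1 * (1 + p * q.1 ^ (k - 1)) * (Λ₀ - q.1 - q.2) - γ * q.1, η * q.1 - q.2)

/-- The continuous linear map `ℝ² → ℝ²` given by the matrix `!![a, b; c, d]`. -/
noncomputable def clm2 (a b c d : ℝ) : ℝ × ℝ →L[ℝ] ℝ × ℝ :=
  (a • ContinuousLinearMap.fst ℝ ℝ ℝ + b • ContinuousLinearMap.snd ℝ ℝ ℝ).prod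
    (c • ContinuousLinearMap.fst ℝ ℝ ℝ + d • ContinuousLinearMap.snd ℝ ℝ ℝ)


noncomputable def gfun (p Λ₀ γ k : ℝ) (q : ℝ × ℝ) : ℝ :=
  (1 + p * q.1 ^ (k - 1)) * (Λ₀ - q.1 - q.2) - γ

lemma gfun_zero (p Λ₀ γ k : ℝ) (hk : 1 < k) : gfun p Λ₀ γ k (0, 0) = Λ₀ - γ := by
  have : (0:ℝ) ^ (k - 1) = 0 := Real.zero_rpow (by linarith)
  simp [gfun, this]

lemma gfun_cont (p Λ₀ γ k : ℝ) (hk : 1 < k) : ContinuousAt (gfun p Λ₀ γ k) (0, 0) := by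
  have h : ContinuousAt (fun q : ℝ × ℝ => q.1 ^ (k - 1)) (0, 0) :=
    continuousAt_fst.rpow_const (Or.inr (by linarith))
  unfold gfun
  fun_prop

lemma star_eq (p Λ₀ γ η k : ℝ) (q : ℝ × ℝ) :
    starVF p Λ₀ γ η k q = (q.1 * gfun p Λ₀ γ k q, η * q.1 - q.2) := by
  unfold starVF gfun
  ext <;> simp <;> ring

lemma star_fderiv (p Λ₀ γ η k : ℝ) (hk : 1 < k) :
    HasFDerivAt (starVF p Λ₀ γ η k) (clm2 (Λ₀ - γ) 0 η (-1)) (0, 0) := by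
  have e : starVF p Λ₀ γ η k = fun q => (q.1 * gfun p Λ₀ γ k q, η * q.1 - q.2) :=
    funext (star_eq p Λ₀ γ η k)
  rw [e]
  unfold clm2
  refine HasFDerivAt.prodMk ?_ ?_
  · rw [hasFDerivAt_iff_isLittleO]
    have h1 : (fun q : ℝ × ℝ => q.1) =O[nhds ((0:ℝ), (0:ℝ))] fun q => q :=
      Asymptotics.isBigO_fst_prod'
    have h2 : (fun q : ℝ × ℝ => gfun p Λ₀ γ k q - (Λ₀ - γ)) =o[nhds ((0:ℝ), (0:ℝ))]
        fun _ => (1:ℝ) := by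
      rw [Asymptotics.isLittleO_one_iff]
      have := (gfun_cont p Λ₀ γ k hk).tendsto
      rw [gfun_zero p Λ₀ γ k hk] at this
      simpa using this.sub_const (Λ₀ - γ)
    have h3 := h1.norm_right.mul_isLittleO h2
    refine (h3.congr ?_ ?_).trans_isBigO (Asymptotics.isBigO_refl _ _).norm_left
    · intro q; simp; ring
    · intro q; simp [← Prod.zero_eq_mk]
  · have h : HasFDerivAt (fun q : ℝ × ℝ => η * q.1 - q.2)
        (η • ContinuousLinearMap.fst ℝ ℝ ℝ - ContinuousLinearMap.snd ℝ ℝ ℝ) (0, 0) :=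
      (hasFDerivAt_fst.const_mul η).sub hasFDerivAt_snd
    refine h.congr_fderiv ?_
    ext <;> simp

lemma eig1 (a η : ℝ) : Module.End.HasEigenvalue (Matrix.toLin' !![a, 0; η, -1]) (-1) := by
  refine Module.End.hasEigenvalue_of_hasEigenvector (x := ![0, 1]) ⟨?_, ?_⟩
  · rw [Module.End.mem_eigenspace_iff]
    ext i; fin_cases i <;> simp [Matrix.mulVec, dotProduct, Fin.sum_univ_two]
  · intro h
    simpa using congrFun h 1

lemma eig2 (a η : ℝ) (hη : 0 < η) :
    Module.End.HasEigenvalue (Matrix.toLin' !![a, 0; η, -1]) a := by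
  refine Module.End.hasEigenvalue_of_hasEigenvector (x := ![a + 1, η] ) ⟨?_, ?_⟩
  · rw [Module.End.mem_eigenspace_iff]
    ext i; fin_cases i <;> simp [Matrix.mulVec, dotProduct, Fin.sum_univ_two]
    ring
  · intro h
    have := congrFun h 1
    simp at this
    exact hη.ne' this

lemma star_stable (p Λ₀ γ η k : ℝ) (hη : 0 < η) (hk : 1 < k) (hlt : Λ₀ < γ) :
    ∃ δ > (0 : ℝ), ∀ sol : ℝ → ℝ × ℝ,
        (∀ t, 0 ≤ t → HasDerivAt sol (starVF p Λ₀ γ η k (sol t)) t) →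
        ‖sol 0‖ < δ →
        Bornology.IsBounded (sol '' Set.Ici 0) ∧
          Filter.Tendsto sol Filter.atTop (nhds ((0 : ℝ), (0 : ℝ))) := by
  obtain ⟨c, hc0, hc⟩ : ∃ c > 0, Λ₀ - γ = -(2 * c) := ⟨(γ - Λ₀) / 2, by linarith, by ring⟩
  have hg : ∀ᶠ q in nhds ((0:ℝ), (0:ℝ)), gfun p Λ₀ γ k q < -c := by
    have := (gfun_cont p Λ₀ γ k hk).tendsto
    rw [gfun_zero p Λ₀ γ k hk] at this
    exact this.eventually (gt_mem_nhds (by linarith))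
  obtain ⟨ε, hε, hball⟩ := Metric.eventually_nhds_iff.1 hg
  obtain ⟨A, hA, hAc⟩ : ∃ A > 0, A * c = η ^ 2 := ⟨η ^ 2 / c, by positivity, by field_simp⟩
  obtain ⟨m, hm0, hmc, hm1⟩ : ∃ m > 0, m ≤ c ∧ m ≤ 1 :=
    ⟨min c 1, lt_min hc0 one_pos, min_le_left _ _, min_le_right _ _⟩
  obtain ⟨B, hB0, hBA, hB1⟩ : ∃ B > 0, B ≤ A ∧ B ≤ 1 :=
    ⟨min A 1, lt_min hA one_pos, min_le_left _ _, min_le_right _ _⟩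
  set r := B * ε ^ 2 with hr
  have hr0 : 0 < r := by positivity
  obtain ⟨δ, hδ, hδr⟩ : ∃ δ > 0, (A + 1) * δ ^ 2 = r / 2 := by
    refine ⟨Real.sqrt (r / 2 / (A + 1)), Real.sqrt_pos.2 (by positivity), ?_⟩
    rw [Real.sq_sqrt (by positivity)]; field_simp
  have hnorm : ∀ q : ℝ × ℝ, B * ‖q‖ ^ 2 ≤ A * q.1 ^ 2 + q.2 ^ 2 := by
    intro q
    have h1 := sq_nonneg q.1
    have h2 := sq_nonneg q.2
    rcases max_cases ‖q.1‖ ‖q.2‖ with ⟨h, _⟩ | ⟨h, _⟩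
    · rw [Prod.norm_def, h, Real.norm_eq_abs, sq_abs]; nlinarith
    · rw [Prod.norm_def, h, Real.norm_eq_abs, sq_abs]; nlinarith
  refine ⟨δ, hδ, fun sol hsol h0 => ?_⟩
  have hx : ∀ t, 0 ≤ t → HasDerivAt (fun t => (sol t).1)
      ((sol t).1 * gfun p Λ₀ γ k (sol t)) t := fun t ht => by
    have := (hsol t ht); rw [star_eq] at this
    exact (hasFDerivAt_fst (𝕜 := ℝ) (p := sol t)).comp_hasDerivAt t this
  have hy : ∀ t, 0 ≤ t → HasDerivAt (fun t => (sol t).2)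
      (η * (sol t).1 - (sol t).2) t := fun t ht => by
    have := (hsol t ht); rw [star_eq] at this
    exact (hasFDerivAt_snd (𝕜 := ℝ) (p := sol t)).comp_hasDerivAt t this
  have hV : ∀ t, 0 ≤ t → HasDerivAt (fun t => A * (sol t).1 ^ 2 + (sol t).2 ^ 2)
      (2 * A * (sol t).1 ^ 2 * gfun p Λ₀ γ k (sol t)
        + 2 * (sol t).2 * (η * (sol t).1 - (sol t).2)) t := fun t ht => by
    refine ((((hx t ht).pow 2).const_mul A).add ((hy t ht).pow 2)).congr_deriv ?_
    push_cast; ring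
  have hE : ∀ t, HasDerivAt (fun t => r / 2 * Real.exp (-(m / 2) * t))
      (-(m / 2) * (r / 2 * Real.exp (-(m / 2) * t))) t := fun t => by
    refine ((((hasDerivAt_id t).const_mul (-(m / 2))).exp).const_mul (r / 2)).congr_deriv ?_
    simp only [id]; ring
  have key : ∀ t, 0 ≤ t →
      A * (sol t).1 ^ 2 + (sol t).2 ^ 2 ≤ r / 2 * Real.exp (-(m / 2) * t) := by
    intro T hT
    refine image_le_of_deriv_right_lt_deriv_boundary' (a := 0) (b := T)
      (f := fun t => A * (sol t).1 ^ 2 + (sol t).2 ^ 2)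
      (B := fun t => r / 2 * Real.exp (-(m / 2) * t))
      (fun t ht => (hV t ht.1).continuousAt.continuousWithinAt)
      (fun t ht => (hV t ht.1).hasDerivWithinAt) ?_
      (fun t ht => (hE t).continuousAt.continuousWithinAt)
      (fun t ht => (hE t).hasDerivWithinAt) ?_ (Set.right_mem_Icc.2 hT)
    · have a1 : |(sol 0).1| < δ := lt_of_le_of_lt (norm_fst_le (sol 0)) h0
      have a2 : |(sol 0).2| < δ := lt_of_le_of_lt (norm_snd_le (sol 0)) h0
      have b1 : (sol 0).1 ^ 2 ≤ δ ^ 2 := sq_le_sq.2 (by rw [abs_of_pos hδ]; exact a1.le)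
      have b2 : (sol 0).2 ^ 2 ≤ δ ^ 2 := sq_le_sq.2 (by rw [abs_of_pos hδ]; exact a2.le)
      show A * (sol 0).1 ^ 2 + (sol 0).2 ^ 2 ≤ r / 2 * Real.exp (-(m / 2) * 0)
      rw [mul_zero, Real.exp_zero]
      nlinarith
    · intro t ht heq
      change A * (sol t).1 ^ 2 + (sol t).2 ^ 2 = r / 2 * Real.exp (-(m / 2) * t) at heq
      rw [← heq]
      have hle : r / 2 * Real.exp (-(m / 2) * t) ≤ r / 2 := by
        have : Real.exp (-(m / 2) * t) ≤ 1 := Real.exp_le_one_iff.2 (by nlinarith [ht.1])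
        nlinarith
      have hpos : 0 < r / 2 * Real.exp (-(m / 2) * t) := by positivity
      have hn : ‖sol t‖ < ε := by
        have h1 := hnorm (sol t)
        have h2 : B * ‖sol t‖ ^ 2 < B * ε ^ 2 := by linarith
        exact lt_of_pow_lt_pow_left₀ 2 hε.le (lt_of_mul_lt_mul_left h2 hB0.le)
      have hgt : gfun p Λ₀ γ k (sol t) < -c := by
        apply hball
        rw [← Prod.zero_eq_mk, dist_zero_right]; exact hn
      rw [← heq] at hpos
      generalize gfun p Λ₀ γ k (sol t) = g at *
      generalize (sol t).1 = x at *
      generalize (sol t).2 = y at *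
      have i1 : A * x ^ 2 * g ≤ A * x ^ 2 * (-c) :=
        mul_le_mul_of_nonneg_left hgt.le (by positivity)
      have i2 := sq_nonneg (η * x - y)
      have i3 : m * (A * x ^ 2) ≤ c * (A * x ^ 2) :=
        mul_le_mul_of_nonneg_right hmc (by positivity)
      have i4 : m * y ^ 2 ≤ 1 * y ^ 2 := mul_le_mul_of_nonneg_right hm1 (by positivity)
      have i5 : A * c * x ^ 2 = η ^ 2 * x ^ 2 := by rw [hAc]
      have i6 := mul_pos hm0 hpos
      nlinarith
  have hbd : ∀ t, 0 ≤ t → ‖sol t‖ ^ 2 ≤ r / 2 / B * Real.exp (-(m / 2) * t) := by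
    intro t ht
    have h1 := (hnorm (sol t)).trans (key t ht)
    have : r / 2 / B * Real.exp (-(m / 2) * t) = (r / 2 * Real.exp (-(m / 2) * t)) / B := by ring
    rw [this, le_div_iff₀ hB0]; linarith
  constructor
  · rw [isBounded_iff_forall_norm_le]
    refine ⟨Real.sqrt (r / 2 / B), ?_⟩
    rintro _ ⟨t, ht, rfl⟩
    have ht : 0 ≤ t := ht
    apply Real.le_sqrt_of_sq_le
    refine (hbd t ht).trans (mul_le_of_le_one_right (by positivity) ?_)
    exact Real.exp_le_one_iff.2 (by nlinarith)
  · have hlim : Filter.Tendsto (fun t => r / 2 / B * Real.exp (-(m / 2) * t))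
        Filter.atTop (nhds 0) := by
      have : Filter.Tendsto (fun t : ℝ => -(m / 2) * t) Filter.atTop Filter.atBot :=
        Filter.tendsto_id.const_mul_atTop_of_neg (by linarith)
      simpa using (Real.tendsto_exp_atBot.comp this).const_mul (r / 2 / B)
    have hsq : Filter.Tendsto (fun t => ‖sol t‖ ^ 2) Filter.atTop (nhds 0) :=
      squeeze_zero' (Filter.Eventually.of_forall fun t => by positivity)
        ((Filter.eventually_ge_atTop 0).mono hbd) hlim
    have := hsq.sqrt
    simp only [Real.sqrt_zero, Real.sqrt_sq (norm_nonneg _)] at this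
    exact tendsto_zero_iff_norm_tendsto_zero.2 this

/-- For `k > 1`, the origin is an equilibrium of (★), the vector field is
differentiable there with derivative `[[Λ₀−γ, 0], [η, −1]]`, whose eigenvalues are `Λ₀−γ`
and `−1`; if `R₀ < 1` (i.e. `Λ₀ < γ`) both eigenvalues are negative and the origin is locally
asymptotically stable, while if `R₀ > 1` the matrix has one positive and one negative
eigenvalue. -/
theorem disease_free_equilibrium_stability
    (p Λ₀ γ η k : ℝ)
    (hp : 0 < p) (hΛ : 0 < Λ₀) (hη : 0 < η) (hγη : η < γ) (hk : 1 < k) :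
    starVF p Λ₀ γ η k (0, 0) = (0, 0) ∧
    HasFDerivAt (starVF p Λ₀ γ η k) (clm2 (Λ₀ - γ) 0 η (-1)) (0, 0) ∧
    Module.End.HasEigenvalue (Matrix.toLin' !![Λ₀ - γ, 0; η, -1]) (Λ₀ - γ) ∧
    Module.End.HasEigenvalue (Matrix.toLin' !![Λ₀ - γ, 0; η, -1]) (-1) ∧
    (Λ₀ < γ →
      (Λ₀ - γ < 0 ∧ (-1 : ℝ) < 0) ∧
      ∃ δ > (0 : ℝ), ∀ sol : ℝ → ℝ × ℝ,
        (∀ t, 0 ≤ t → HasDerivAt sol (starVF p Λ₀ γ η k (sol t)) t) →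
        ‖sol 0‖ < δ →
        Bornology.IsBounded (sol '' Set.Ici 0) ∧
          Filter.Tendsto sol Filter.atTop (nhds ((0 : ℝ), (0 : ℝ)))) ∧
    (γ < Λ₀ → ∃ u v : ℝ, 0 < u ∧ v < 0 ∧
      Module.End.HasEigenvalue (Matrix.toLin' !![Λ₀ - γ, 0; η, -1]) u ∧
      Module.End.HasEigenvalue (Matrix.toLin' !![Λ₀ - γ, 0; η, -1]) v) := by
  refine ⟨?_, star_fderiv p Λ₀ γ η k hk, eig2 _ _ hη, eig1 _ _, ?_, ?_⟩
  · rw [star_eq]; simp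
  · intro h
    exact ⟨⟨by linarith, by norm_num⟩, star_stable p Λ₀ γ η k hη hk h⟩
  · intro h
    exact ⟨Λ₀ - γ, -1, by linarith, by norm_num, eig2 _ _ hη, eig1 _ _⟩
end

section
/- Assume 0 < k < 1. Then H is strictly decreasing on (0, Λ₀/(1+η)], H(x) → +∞ as x → 0⁺, and H(Λ₀/(1+η)) = −γ/Λ₀ < 0. Consequently H has exactly one zero x₀* in (0, Λ₀/(1+η)), system (★) has exactly one positive equilibrium, namely (x₀*, η·x₀*), and H'(x₀*) < 0. -/
/-- The function `H(x) = (1+p·x^(k−1))·(1 − (1+η)x/Λ₀) − γ/Λ₀`. -/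
noncomputable def Hfun (p Λ₀ γ η k : ℝ) (x : ℝ) : ℝ :=
  (1 + p * x ^ (k - 1)) * (1 - (1 + η) * x / Λ₀) - γ / Λ₀

/-- For `0 < k < 1`, `H` is strictly decreasing on `(0, Λ₀/(1+η)]`,
`H(x) → +∞` as `x → 0⁺`, `H(Λ₀/(1+η)) = −γ/Λ₀ < 0`; hence `H` has exactly one zero `x₀*`
in `(0, Λ₀/(1+η))`, system (★) has exactly one positive equilibrium `(x₀*, η·x₀*)`,
and `H'(x₀*) < 0`. -/
theorem unique_endemic_equilibrium_of_k_lt_one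
    (p Λ₀ γ η k : ℝ)
    (hp : 0 < p) (hΛ : 0 < Λ₀) (hη : 0 < η) (hγη : η < γ)
    (hk0 : 0 < k) (hk1 : k < 1) :
    StrictAntiOn (Hfun p Λ₀ γ η k) (Set.Ioc 0 (Λ₀ / (1 + η))) ∧
    Filter.Tendsto (Hfun p Λ₀ γ η k) (nhdsWithin 0 (Set.Ioi 0)) Filter.atTop ∧
    Hfun p Λ₀ γ η k (Λ₀ / (1 + η)) = -γ / Λ₀ ∧ -γ / Λ₀ < 0 ∧
    ∃ x₀ ∈ Set.Ioo (0 : ℝ) (Λ₀ / (1 + η)),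
      Hfun p Λ₀ γ η k x₀ = 0 ∧
      (∀ x ∈ Set.Ioc (0 : ℝ) (Λ₀ / (1 + η)), Hfun p Λ₀ γ η k x = 0 → x = x₀) ∧
      starVF p Λ₀ γ η k (x₀, η * x₀) = (0, 0) ∧
      (∀ x y : ℝ, 0 < x → starVF p Λ₀ γ η k (x, y) = (0, 0) → x = x₀ ∧ y = η * x₀) ∧
      deriv (Hfun p Λ₀ γ η k) x₀ < 0 := by
  have h1η : 0 < 1 + η := by linarith
  have hγ : 0 < γ := by linarith
  have hb : 0 < Λ₀ / (1 + η) := by positivity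
  have hHeq : ∀ x, Hfun p Λ₀ γ η k x =
      ((1 + p * x ^ (k - 1)) * (Λ₀ - (1 + η) * x) - γ) / Λ₀ := by
    intro x
    unfold Hfun
    field_simp
  have hneg : -γ / Λ₀ < 0 := div_neg_of_neg_of_pos (by linarith) hΛ
  have hend : Hfun p Λ₀ γ η k (Λ₀ / (1 + η)) = -γ / Λ₀ := by
    rw [hHeq, mul_div_cancel₀ _ h1η.ne']
    simp
  have hanti : StrictAntiOn (Hfun p Λ₀ γ η k) (Set.Ioc 0 (Λ₀ / (1 + η))) := by
    intro a ha b hb' hab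
    rw [hHeq, hHeq]
    have hu : b ^ (k - 1) < a ^ (k - 1) :=
      Real.rpow_lt_rpow_of_neg ha.1 hab (by linarith)
    have hua : 0 < a ^ (k - 1) := Real.rpow_pos_of_pos ha.1 _
    have hvb : 0 ≤ Λ₀ - (1 + η) * b := by
      have := (le_div_iff₀ h1η).1 hb'.2
      linarith
    have hv : Λ₀ - (1 + η) * b < Λ₀ - (1 + η) * a := by
      have := mul_lt_mul_of_pos_left hab h1η
      linarith
    have h1 : (1 + p * b ^ (k - 1)) * (Λ₀ - (1 + η) * b)
        ≤ (1 + p * a ^ (k - 1)) * (Λ₀ - (1 + η) * b) := by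
      gcongr
    have h2 : (1 + p * a ^ (k - 1)) * (Λ₀ - (1 + η) * b)
        < (1 + p * a ^ (k - 1)) * (Λ₀ - (1 + η) * a) :=
      mul_lt_mul_of_pos_left hv (by positivity)
    apply div_lt_div_of_pos_right _ hΛ
    linarith
  have hlim : Filter.Tendsto (Hfun p Λ₀ γ η k) (nhdsWithin 0 (Set.Ioi 0)) Filter.atTop := by
    have h1 : Filter.Tendsto (fun x : ℝ => x ^ (k - 1)) (nhdsWithin 0 (Set.Ioi 0))
        Filter.atTop := tendsto_rpow_neg_nhdsGT_zero (by linarith)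
    have h2 : Filter.Tendsto (fun x : ℝ => 1 + p * x ^ (k - 1)) (nhdsWithin 0 (Set.Ioi 0))
        Filter.atTop :=
      Filter.tendsto_atTop_add_const_left _ _ (h1.const_mul_atTop hp)
    have h3 : Filter.Tendsto (fun x : ℝ => 1 - (1 + η) * x / Λ₀) (nhdsWithin 0 (Set.Ioi 0))
        (nhds 1) := by
      have hc : Continuous (fun x : ℝ => 1 - (1 + η) * x / Λ₀) := by fun_prop
      have := hc.tendsto 0
      simp only [mul_zero, zero_div, sub_zero] at this
      exact this.mono_left nhdsWithin_le_nhds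
    have h4 := Filter.tendsto_atTop_add_const_right _ (-(γ / Λ₀))
      (h2.atTop_mul_pos one_pos h3)
    exact h4
  have hderiv : ∀ x, 0 < x → HasDerivAt (Hfun p Λ₀ γ η k)
      ((p * ((k - 1) * x ^ (k - 1 - 1))) * (1 - (1 + η) * x / Λ₀) +
        (1 + p * x ^ (k - 1)) * (-((1 + η) * 1 / Λ₀))) x := by
    intro x hx
    have h1 := ((Real.hasDerivAt_rpow_const (p := k - 1) (Or.inl hx.ne')).const_mul p).const_add 1
    have h2 := (((hasDerivAt_id x).const_mul (1 + η)).div_const Λ₀).const_sub 1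
    exact (h1.mul h2).sub_const (γ / Λ₀)
  refine ⟨hanti, hlim, hend, hneg, ?_⟩
  obtain ⟨a, haH, ha⟩ := ((hlim.eventually_gt_atTop 0).and
    (Ioo_mem_nhdsGT hb)).exists
  have hcont : ContinuousOn (Hfun p Λ₀ γ η k) (Set.Icc a (Λ₀ / (1 + η))) := fun x hx =>
    (hderiv x (lt_of_lt_of_le ha.1 hx.1)).continuousAt.continuousWithinAt
  obtain ⟨x₀, hx₀, hz⟩ := intermediate_value_Ioo' ha.2.le hcont
    (show (0 : ℝ) ∈ Set.Ioo _ _ from ⟨by rw [hend]; exact hneg, haH⟩)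
  have hx0 : 0 < x₀ := ha.1.trans hx₀.1
  have huniq : ∀ x ∈ Set.Ioc (0 : ℝ) (Λ₀ / (1 + η)), Hfun p Λ₀ γ η k x = 0 → x = x₀ :=
    fun x hx h => hanti.injOn hx ⟨hx0, hx₀.2.le⟩ (h.trans hz.symm)
  refine ⟨x₀, ⟨hx0, hx₀.2⟩, hz, huniq, ?_, ?_, ?_⟩
  · have h := hz
    rw [hHeq, div_eq_zero_iff] at h
    have h' := h.resolve_right hΛ.ne'
    simp only [starVF, Prod.mk.injEq]
    exact ⟨by linear_combination x₀ * h', by ring⟩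
  · intro x y hx h
    simp only [starVF, Prod.mk.injEq] at h
    obtain ⟨he, hy⟩ := h
    have hy' : y = η * x := by linarith
    subst hy'
    have hprod : (1 + p * x ^ (k - 1)) * (Λ₀ - (1 + η) * x) - γ = 0 := by
      apply mul_left_cancel₀ hx.ne'
      linear_combination he
    have hu : 0 < x ^ (k - 1) := Real.rpow_pos_of_pos hx _
    have hpos : 0 < Λ₀ - (1 + η) * x := by
      refine pos_of_mul_pos_right (a := 1 + p * x ^ (k - 1)) ?_ (by positivity)
      linarith
    have hxe : x = x₀ := by
      refine huniq x ⟨hx, ?_⟩ ?_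
      · rw [le_div_iff₀ h1η]
        linarith
      · rw [hHeq, hprod, zero_div]
    exact ⟨hxe, by rw [hxe]⟩
  · rw [(hderiv x₀ hx0).deriv]
    have hu : 0 < x₀ ^ (k - 1) := Real.rpow_pos_of_pos hx0 _
    have hw : 0 < x₀ ^ (k - 1 - 1) := Real.rpow_pos_of_pos hx0 _
    have hv : 0 < 1 - (1 + η) * x₀ / Λ₀ := by
      have := (lt_div_iff₀ h1η).1 hx₀.2
      rw [sub_pos, div_lt_one hΛ]
      linarith
    have h1 : 0 < (p * ((1 - k) * x₀ ^ (k - 1 - 1))) * (1 - (1 + η) * x₀ / Λ₀) :=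
      mul_pos (mul_pos hp (mul_pos (by linarith) hw)) hv
    have h2 : 0 < (1 + p * x₀ ^ (k - 1)) * ((1 + η) * 1 / Λ₀) := by positivity
    linarith
end

section
/- Assume k = 1 and Λ₀·(1 + p) > γ. Then H has the unique zero x₁* = (Λ₀ + p·Λ₀ − γ)/((1+p)·(1+η)) in (0, Λ₀/(1+η)), so (x₁*, η·x₁*) is the unique positive equilibrium of system (★); moreover the Jacobian matrix of the vector field of (★) at (x₁*, η·x₁*) has trace −(1+p)·x₁* − 1 < 0 and determinant (1+p)·(1+η)·x₁* > 0, so both of its eigenvalues have negative real part. -/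
/-- For `k = 1` and `Λ₀(1+p) > γ`, `H` has the unique zero
`x₁* = (Λ₀+pΛ₀−γ)/((1+p)(1+η))` in `(0, Λ₀/(1+η))`, `(x₁*, η·x₁*)` is the unique positive
equilibrium of (★); the Jacobian there has trace `−(1+p)x₁*−1 < 0` and determinant
`(1+p)(1+η)x₁* > 0`, so both eigenvalues have negative real part. -/
theorem unique_endemic_equilibrium_of_k_eq_one
    (p Λ₀ γ η x₁ : ℝ)
    (hp : 0 < p) (hΛ : 0 < Λ₀) (hη : 0 < η) (hγη : η < γ)
    (hcond : γ < Λ₀ * (1 + p))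
    (hx₁ : x₁ = (Λ₀ + p * Λ₀ - γ) / ((1 + p) * (1 + η))) :
    x₁ ∈ Set.Ioo (0 : ℝ) (Λ₀ / (1 + η)) ∧
    Hfun p Λ₀ γ η 1 x₁ = 0 ∧
    (∀ x ∈ Set.Ioc (0 : ℝ) (Λ₀ / (1 + η)), Hfun p Λ₀ γ η 1 x = 0 → x = x₁) ∧
    starVF p Λ₀ γ η 1 (x₁, η * x₁) = (0, 0) ∧
    (∀ x y : ℝ, 0 < x → starVF p Λ₀ γ η 1 (x, y) = (0, 0) → x = x₁ ∧ y = η * x₁) ∧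
    ∃ a b : ℝ,
      HasFDerivAt (starVF p Λ₀ γ η 1) (clm2 a b η (-1)) (x₁, η * x₁) ∧
      Matrix.trace !![a, b; η, -1] = -((1 + p) * x₁) - 1 ∧
      -((1 + p) * x₁) - 1 < 0 ∧
      Matrix.det !![a, b; η, -1] = (1 + p) * (1 + η) * x₁ ∧
      0 < (1 + p) * (1 + η) * x₁ ∧
      ∀ μ : ℂ, Module.End.HasEigenvalue
          (Matrix.toLin' ((!![a, b; η, -1]).map (Complex.ofReal ·))) μ → μ.re < 0 := by
  have h1p : 0 < 1 + p := by linarith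
  have h1η : 0 < 1 + η := by linarith
  have hγ : 0 < γ := by linarith
  have key : (1 + p) * (1 + η) * x₁ = Λ₀ + p * Λ₀ - γ := by
    rw [hx₁]; field_simp
  have hpos : 0 < x₁ := by
    rw [hx₁]
    apply div_pos
    · nlinarith
    · positivity
  have hdet : 0 < (1 + p) * (1 + η) * x₁ := by positivity
  have huniq : ∀ x : ℝ, (1 + p) * (1 + η) * x = Λ₀ + p * Λ₀ - γ → x = x₁ := by
    intro x hx
    have hne : (1 + p) * (1 + η) ≠ 0 := by positivity
    exact mul_left_cancel₀ hne (hx.trans key.symm)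
  have hH : ∀ x : ℝ, Hfun p Λ₀ γ η 1 x
      = (Λ₀ + p * Λ₀ - γ - (1 + p) * (1 + η) * x) / Λ₀ := by
    intro x
    simp only [Hfun, sub_self, Real.rpow_zero]
    field_simp
    ring
  have hF : starVF p Λ₀ γ η 1 = fun q : ℝ × ℝ =>
      (q.1 * (1 + p) * (Λ₀ - q.1 - q.2) - γ * q.1, η * q.1 - q.2) := by
    funext q
    simp [starVF]
  refine ⟨⟨hpos, ?_⟩, ?_, ?_, ?_, ?_, -((1 + p) * x₁), -((1 + p) * x₁), ?_, ?_, ?_, ?_, hdet, ?_⟩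
  · rw [lt_div_iff₀ h1η]
    by_contra hcon
    push Not at hcon
    nlinarith [mul_le_mul_of_nonneg_left hcon h1p.le]
  · rw [hH, key]; simp
  · intro x _ hx
    rw [hH, div_eq_zero_iff] at hx
    rcases hx with hx | hx
    · exact huniq x (by linarith)
    · exact absurd hx hΛ.ne'
  · rw [hF]
    simp only [Prod.mk.injEq]
    constructor
    · linear_combination (-x₁) * key
    · ring
  · intro x y hx h
    rw [hF] at h
    simp only [Prod.mk.injEq] at h
    obtain ⟨h1, h2⟩ := h
    have hy : y = η * x := by linarith
    subst hy
    have hxx : x = x₁ := by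
      apply huniq
      apply mul_left_cancel₀ hx.ne'
      linear_combination -h1
    exact ⟨hxx, by rw [hxx]⟩
  · rw [hF]
    have e1 : HasFDerivAt (fun q : ℝ × ℝ => q.1) (ContinuousLinearMap.fst ℝ ℝ ℝ)
      (x₁, η * x₁) := hasFDerivAt_fst
    have e2 : HasFDerivAt (fun q : ℝ × ℝ => q.2) (ContinuousLinearMap.snd ℝ ℝ ℝ)
      (x₁, η * x₁) := hasFDerivAt_snd
    have hd := (((e1.mul_const (1 + p)).mul ((e1.const_sub Λ₀).sub e2)).sub
      (e1.const_mul γ)).prodMk ((e1.const_mul η).sub e2)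
    refine hd.congr_fderiv ?_
    ext <;> simp [clm2] <;> first | ring1 | linear_combination -key | linear_combination key
  · simp [Matrix.trace_fin_two]; ring
  · have : 0 < (1 + p) * x₁ := by positivity
    linarith
  · simp [Matrix.det_fin_two]; ring
  · intro μ hμ
    obtain ⟨v, hv⟩ := hμ.exists_hasEigenvector
    have hv1 := hv.apply_eq_smul
    have hv0 := hv.2
    have c0 := congrFun hv1 0
    have c1 := congrFun hv1 1
    simp [Matrix.toLin'_apply, Matrix.mulVec, dotProduct, Fin.sum_univ_two] at c0 c1
    set A : ℝ := (1 + p) * x₁ with hA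
    have hApos : 0 < A := by positivity
    have hchar : μ ^ 2 + ((A : ℂ) + 1) * μ + (A : ℂ) * (1 + η) = 0 := by
      have hAc : (A : ℂ) = (1 + p) * x₁ := by rw [hA]; push_cast; ring
      rw [← hAc] at c0
      have q0 : (μ ^ 2 + ((A : ℂ) + 1) * μ + (A : ℂ) * (1 + η)) * v 0 = 0 := by
        linear_combination (-(μ + 1)) * c0 + (A : ℂ) * c1
      have q1 : (μ ^ 2 + ((A : ℂ) + 1) * μ + (A : ℂ) * (1 + η)) * v 1 = 0 := by
        linear_combination (-(η : ℂ)) * c0 - (μ + A) * c1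
      by_contra hne
      apply hv0
      funext i
      fin_cases i
      · exact (mul_eq_zero.mp q0).resolve_left hne
      · exact (mul_eq_zero.mp q1).resolve_left hne
    have hre := congrArg Complex.re hchar
    have him := congrArg Complex.im hchar
    simp [pow_two] at hre him
    by_contra hcon
    push Not at hcon
    have him0 : μ.im = 0 := by
      have : (2 * μ.re + A + 1) * μ.im = 0 := by linarith
      rcases mul_eq_zero.mp this with h | h
      · linarith
      · exact h
    rw [him0] at hre
    nlinarith [mul_pos hApos h1η, mul_nonneg hcon hcon, mul_nonneg hApos.le hcon]
end

section
/- Assume 1 < k < 2. Then H''(x) = p·(k−1)·x^(k−3)·(k − 2 − k·(1+η)·x/Λ₀) < 0 for all x ∈ (0, Λ₀/(1+η)), so H' is strictly decreasing there; moreover H'(x) → +∞ as x → 0⁺ and H'(x) → −((1+η)^(k−1) + p·Λ₀^(k−1))/(Λ₀·(1+η)^(k−2)) < 0 as x → (Λ₀/(1+η))⁻. Hence H' has a unique zero x_c in (0, Λ₀/(1+η)), and H is strictly increasing on (0, x_c) and strictly decreasing on (x_c, Λ₀/(1+η)]. -/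
/-- Explicit first derivative of `Hfun`. -/
noncomputable def Gfun (p Λ₀ η k : ℝ) (x : ℝ) : ℝ :=
  p * ((k - 1) * x ^ (k - 2)) * (1 - (1 + η) * x / Λ₀)
    + (1 + p * x ^ (k - 1)) * (-((1 + η) / Λ₀))

lemma lin_hasDerivAt (Λ₀ η x : ℝ) :
    HasDerivAt (fun x : ℝ => 1 - (1 + η) * x / Λ₀) (-((1 + η) / Λ₀)) x := by
  have h := (((hasDerivAt_id x).const_mul (1 + η)).div_const Λ₀).const_sub 1
  simpa using h

lemma Hfun_hasDerivAt (p Λ₀ γ η k x : ℝ) (hx : 0 < x) :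
    HasDerivAt (Hfun p Λ₀ γ η k) (Gfun p Λ₀ η k x) x := by
  have h1 := ((Real.hasDerivAt_rpow_const (x := x) (p := k - 1) (Or.inl hx.ne')).const_mul p).const_add 1
  have h := (h1.mul (lin_hasDerivAt Λ₀ η x)).sub_const (γ / Λ₀)
  have e : k - 1 - 1 = k - 2 := by ring
  rw [e] at h
  exact h

lemma Gfun_hasDerivAt (p Λ₀ η k x : ℝ) (hx : 0 < x) :
    HasDerivAt (Gfun p Λ₀ η k)
      (p * (k - 1) * x ^ (k - 3) * (k - 2 - k * (1 + η) * x / Λ₀)) x := by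
  have h1 := ((Real.hasDerivAt_rpow_const (x := x) (p := k - 1) (Or.inl hx.ne')).const_mul p).const_add 1
  have h2 := ((Real.hasDerivAt_rpow_const (x := x) (p := k - 2) (Or.inl hx.ne')).const_mul (k - 1)).const_mul p
  have h := (h2.mul (lin_hasDerivAt Λ₀ η x)).add (h1.mul_const (-((1 + η) / Λ₀)))
  have e : k - 1 - 1 = k - 2 := by ring
  have e2 : k - 2 - 1 = k - 3 := by ring
  have e3 : x ^ (k - 2) = x ^ (k - 3) * x := by
    rw [← Real.rpow_add_one hx.ne']; congr 1; ring
  rw [e, e2, e3] at h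
  refine HasDerivAt.congr_deriv h ?_
  ring

/-- For `1 < k < 2`: `H''(x) = p(k−1)x^(k−3)(k−2−k(1+η)x/Λ₀) < 0` on
`(0, Λ₀/(1+η))`, so `H'` is strictly decreasing there; `H'(x) → +∞` as `x → 0⁺` and
`H'(x) → −((1+η)^(k−1)+pΛ₀^(k−1))/(Λ₀(1+η)^(k−2)) < 0` as `x → (Λ₀/(1+η))⁻`. Hence `H'` has
a unique zero `x_c` in `(0, Λ₀/(1+η))`, `H` is strictly increasing on `(0, x_c)` and
strictly decreasing on `(x_c, Λ₀/(1+η)]`. -/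
theorem H_deriv_unique_zero_of_one_lt_k_lt_two
    (p Λ₀ γ η k : ℝ)
    (hp : 0 < p) (hΛ : 0 < Λ₀) (hη : 0 < η) (hγη : η < γ)
    (hk1 : 1 < k) (hk2 : k < 2) :
    (∀ x ∈ Set.Ioo (0 : ℝ) (Λ₀ / (1 + η)),
      deriv (deriv (Hfun p Λ₀ γ η k)) x
          = p * (k - 1) * x ^ (k - 3) * (k - 2 - k * (1 + η) * x / Λ₀) ∧
      p * (k - 1) * x ^ (k - 3) * (k - 2 - k * (1 + η) * x / Λ₀) < 0) ∧
    StrictAntiOn (deriv (Hfun p Λ₀ γ η k)) (Set.Ioo 0 (Λ₀ / (1 + η))) ∧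
    Filter.Tendsto (deriv (Hfun p Λ₀ γ η k)) (nhdsWithin 0 (Set.Ioi 0)) Filter.atTop ∧
    Filter.Tendsto (deriv (Hfun p Λ₀ γ η k))
      (nhdsWithin (Λ₀ / (1 + η)) (Set.Iio (Λ₀ / (1 + η))))
      (nhds (-(((1 + η) ^ (k - 1) + p * Λ₀ ^ (k - 1)) / (Λ₀ * (1 + η) ^ (k - 2))))) ∧
    -(((1 + η) ^ (k - 1) + p * Λ₀ ^ (k - 1)) / (Λ₀ * (1 + η) ^ (k - 2))) < 0 ∧
    ∃ xc ∈ Set.Ioo (0 : ℝ) (Λ₀ / (1 + η)),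
      deriv (Hfun p Λ₀ γ η k) xc = 0 ∧
      (∀ x ∈ Set.Ioo (0 : ℝ) (Λ₀ / (1 + η)), deriv (Hfun p Λ₀ γ η k) x = 0 → x = xc) ∧
      StrictMonoOn (Hfun p Λ₀ γ η k) (Set.Ioo 0 xc) ∧
      StrictAntiOn (Hfun p Λ₀ γ η k) (Set.Ioc xc (Λ₀ / (1 + η))) := by
  have hη1 : 0 < 1 + η := by linarith
  set b := Λ₀ / (1 + η) with hb
  have hb0 : 0 < b := by positivity
  have hd : ∀ x, 0 < x → deriv (Hfun p Λ₀ γ η k) x = Gfun p Λ₀ η k x :=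
    fun x hx => (Hfun_hasDerivAt p Λ₀ γ η k x hx).deriv
  have hneg : ∀ x, 0 < x →
      p * (k - 1) * x ^ (k - 3) * (k - 2 - k * (1 + η) * x / Λ₀) < 0 := by
    intro x hx
    apply mul_neg_of_pos_of_neg
    · have := Real.rpow_pos_of_pos hx (k - 3)
      have : 0 < k - 1 := by linarith
      positivity
    · have : 0 < k * (1 + η) * x / Λ₀ := by
        have : 0 < k := by linarith
        positivity
      linarith
  have hdd : ∀ x, 0 < x → deriv (deriv (Hfun p Λ₀ γ η k)) x
      = p * (k - 1) * x ^ (k - 3) * (k - 2 - k * (1 + η) * x / Λ₀) := by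
    intro x hx
    have : deriv (Hfun p Λ₀ γ η k) =ᶠ[nhds x] Gfun p Λ₀ η k := by
      filter_upwards [Ioi_mem_nhds hx] with y hy using hd y hy
    rw [this.deriv_eq]
    exact (Gfun_hasDerivAt p Λ₀ η k x hx).deriv
  have hcont : ContinuousOn (deriv (Hfun p Λ₀ γ η k)) (Set.Ioi 0) := by
    have : ContinuousOn (Gfun p Λ₀ η k) (Set.Ioi 0) := fun x hx =>
      (Gfun_hasDerivAt p Λ₀ η k x hx).continuousAt.continuousWithinAt
    exact this.congr fun x hx => hd x hx
  have hHcont : ContinuousOn (Hfun p Λ₀ γ η k) (Set.Ioi 0) := fun x hx =>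
      (Hfun_hasDerivAt p Λ₀ γ η k x hx).continuousAt.continuousWithinAt
  have hanti : StrictAntiOn (deriv (Hfun p Λ₀ γ η k)) (Set.Ioo 0 b) := by
    apply strictAntiOn_of_deriv_neg (convex_Ioo 0 b) (hcont.mono fun x hx => hx.1)
    intro x hx
    rw [interior_Ioo] at hx
    rw [hdd x hx.1]
    exact hneg x hx.1
  have htop : Filter.Tendsto (deriv (Hfun p Λ₀ γ η k)) (nhdsWithin 0 (Set.Ioi 0)) Filter.atTop := by
    have hG : Filter.Tendsto (Gfun p Λ₀ η k) (nhdsWithin 0 (Set.Ioi 0)) Filter.atTop := by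
      have t1 : Filter.Tendsto (fun x : ℝ => x ^ (k - 2)) (nhdsWithin 0 (Set.Ioi 0)) Filter.atTop :=
        tendsto_rpow_neg_nhdsGT_zero (by linarith)
      have t2 : Filter.Tendsto (fun x : ℝ => p * ((k - 1) * x ^ (k - 2)))
          (nhdsWithin 0 (Set.Ioi 0)) Filter.atTop :=
        (t1.const_mul_atTop (by linarith : 0 < k - 1)).const_mul_atTop hp
      have t3 : Filter.Tendsto (fun x : ℝ => 1 - (1 + η) * x / Λ₀)
          (nhdsWithin 0 (Set.Ioi 0)) (nhds 1) := by
        have := (lin_hasDerivAt Λ₀ η 0).continuousAt.tendsto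
        simp only [mul_zero, zero_div, sub_zero] at this
        exact this.mono_left nhdsWithin_le_nhds
      have t4 : Filter.Tendsto (fun x : ℝ => (1 + p * x ^ (k - 1)) * (-((1 + η) / Λ₀)))
          (nhdsWithin 0 (Set.Ioi 0)) (nhds ((1 + p * 0 ^ (k - 1)) * (-((1 + η) / Λ₀)))) := by
        have c : Filter.Tendsto (fun x : ℝ => x ^ (k - 1)) (nhds 0) (nhds (0 ^ (k - 1))) :=
          (Real.continuousAt_rpow_const 0 (k - 1) (Or.inr (by linarith))).tendsto
        exact (((c.const_mul p).const_add 1).mul_const _).mono_left nhdsWithin_le_nhds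
      exact (t2.atTop_mul_pos one_pos t3).atTop_add t4
    refine hG.congr' ?_
    filter_upwards [self_mem_nhdsWithin] with x hx using (hd x hx).symm
  have hval : deriv (Hfun p Λ₀ γ η k) b
      = -(((1 + η) ^ (k - 1) + p * Λ₀ ^ (k - 1)) / (Λ₀ * (1 + η) ^ (k - 2))) := by
    rw [hd b hb0]
    have e1 : 1 - (1 + η) * b / Λ₀ = 0 := by rw [hb]; field_simp; ring
    have e2 : (1 + η) ^ (k - 1) = (1 + η) ^ (k - 2) * (1 + η) := by
      rw [← Real.rpow_add_one hη1.ne']; congr 1; ring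
    have e3 : b ^ (k - 1) = Λ₀ ^ (k - 1) / (1 + η) ^ (k - 1) := Real.div_rpow hΛ.le hη1.le _
    have := Real.rpow_pos_of_pos hη1 (k - 2)
    unfold Gfun
    rw [e1, e3, e2]
    field_simp
    ring
  have hlim : Filter.Tendsto (deriv (Hfun p Λ₀ γ η k)) (nhdsWithin b (Set.Iio b))
      (nhds (-(((1 + η) ^ (k - 1) + p * Λ₀ ^ (k - 1)) / (Λ₀ * (1 + η) ^ (k - 2))))) := by
    rw [← hval]
    exact (hcont.continuousAt (Ioi_mem_nhds hb0)).tendsto.mono_left nhdsWithin_le_nhds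
  have hlneg : -(((1 + η) ^ (k - 1) + p * Λ₀ ^ (k - 1)) / (Λ₀ * (1 + η) ^ (k - 2))) < 0 := by
    have := Real.rpow_pos_of_pos hη1 (k - 2)
    have := Real.rpow_pos_of_pos hη1 (k - 1)
    have := Real.rpow_pos_of_pos hΛ (k - 1)
    rw [neg_lt_zero]
    positivity
  refine ⟨fun x hx => ⟨hdd x hx.1, hneg x hx.1⟩, hanti, htop, hlim, hlneg, ?_⟩
  obtain ⟨x1, hx1, hx1m⟩ := ((htop.eventually_gt_atTop 0).and (Ioo_mem_nhdsGT hb0)).exists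
  obtain ⟨x2, hx2, hx2m⟩ := ((hlim.eventually_lt_const hlneg).and (Ioo_mem_nhdsLT hb0)).exists
  obtain ⟨xc, hxc, hxc0⟩ := isPreconnected_Ioo.intermediate_value hx2m hx1m
    (hcont.mono fun x (hx : x ∈ Set.Ioo 0 b) => hx.1) ⟨hx2.le, hx1.le⟩
  refine ⟨xc, hxc, hxc0, fun x hx h => hanti.injOn hx hxc (h.trans hxc0.symm), ?_, ?_⟩
  · apply strictMonoOn_of_deriv_pos (convex_Ioo 0 xc) (hHcont.mono fun x hx => hx.1)
    intro x hx
    rw [interior_Ioo] at hx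
    rw [← hxc0]
    exact hanti ⟨hx.1, hx.2.trans hxc.2⟩ hxc hx.2
  · apply strictAntiOn_of_deriv_neg (convex_Ioc xc b) (hHcont.mono fun x hx => hxc.1.trans hx.1)
    intro x hx
    rw [interior_Ioc] at hx
    rw [← hxc0]
    exact hanti hxc ⟨hxc.1.trans hx.1, hx.2⟩ hx.1
end

section
/- Assume k = 2, and set Δ = (p·Λ₀ − η − 1)² − 4·p·(1+η)·(γ − Λ₀). Then: (a) if R₀ < 1, p > (1+η)/Λ₀ and γ < (1 + η + p·Λ₀)²/(4·p·(1+η)), then Δ > 0 and H has exactly two zeros in (0, Λ₀/(1+η)), namely x₀₁* = (p·Λ₀ − η − 1 − √Δ)/(2·p·(1+η)) and x₀₂* = (p·Λ₀ − η − 1 + √Δ)/(2·p·(1+η)); (b) if R₀ > 1, then H has exactly one zero in (0, Λ₀/(1+η)), namely x₀₂*; (c) if γ = (1 + η + p·Λ₀)²/(4·p·(1+η)) and p·Λ₀ > 1 + η, then H has the unique zero x̄₀* = (p·Λ₀ − η − 1)/(2·p·(1+η)). -/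
theorem Hfun_two_iff (p Λ₀ γ η Δ x : ℝ) (hp : 0 < p) (hΛ : 0 < Λ₀) (hη : 0 < η)
    (hΔ : Δ = (p * Λ₀ - η - 1) ^ 2 - 4 * p * (1 + η) * (γ - Λ₀)) :
    Hfun p Λ₀ γ η 2 x = 0 ↔ (2 * p * (1 + η) * x - (p * Λ₀ - η - 1)) ^ 2 = Δ := by
  have e : (2 : ℝ) - 1 = 1 := by norm_num
  have hA : 0 < 4 * p * (1 + η) := by positivity
  have key : (2 * p * (1 + η) * x - (p * Λ₀ - η - 1)) ^ 2 - Δ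
      = -(4 * p * (1 + η) * Λ₀) * Hfun p Λ₀ γ η 2 x := by
    unfold Hfun
    rw [e, Real.rpow_one, hΔ]
    field_simp
    ring
  have hne : -(4 * p * (1 + η) * Λ₀) ≠ 0 := by
    have : 0 < 4 * p * (1 + η) * Λ₀ := by positivity
    linarith
  rw [← sub_eq_zero (b := Δ), key, mul_eq_zero]
  simp only [hne, false_or]

/-- For `k = 2` with `Δ = (pΛ₀−η−1)² − 4p(1+η)(γ−Λ₀)`:
(a) if `R₀ < 1`, `p > (1+η)/Λ₀` and `γ < (1+η+pΛ₀)²/(4p(1+η))`, then `Δ > 0` and `H` has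
exactly the two zeros `x₀₁* = (pΛ₀−η−1−√Δ)/(2p(1+η))` and `x₀₂* = (pΛ₀−η−1+√Δ)/(2p(1+η))`
in `(0, Λ₀/(1+η))`;
(b) if `R₀ > 1`, `H` has exactly one zero in `(0, Λ₀/(1+η))`, namely `x₀₂*`;
(c) if `γ = (1+η+pΛ₀)²/(4p(1+η))` and `pΛ₀ > 1+η`, then `H` has the unique zero
`x̄₀* = (pΛ₀−η−1)/(2p(1+η))`. -/
theorem H_zeros_of_k_eq_two
    (p Λ₀ γ η Δ x₀₁ x₀₂ : ℝ)
    (hp : 0 < p) (hΛ : 0 < Λ₀) (hη : 0 < η) (hγη : η < γ)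
    (hΔ : Δ = (p * Λ₀ - η - 1) ^ 2 - 4 * p * (1 + η) * (γ - Λ₀))
    (hx₀₁ : x₀₁ = (p * Λ₀ - η - 1 - Real.sqrt Δ) / (2 * p * (1 + η)))
    (hx₀₂ : x₀₂ = (p * Λ₀ - η - 1 + Real.sqrt Δ) / (2 * p * (1 + η))) :
    (Λ₀ / γ < 1 → (1 + η) / Λ₀ < p → γ < (1 + η + p * Λ₀) ^ 2 / (4 * p * (1 + η)) →
      0 < Δ ∧
      x₀₁ ∈ Set.Ioo (0 : ℝ) (Λ₀ / (1 + η)) ∧ Hfun p Λ₀ γ η 2 x₀₁ = 0 ∧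
      x₀₂ ∈ Set.Ioo (0 : ℝ) (Λ₀ / (1 + η)) ∧ Hfun p Λ₀ γ η 2 x₀₂ = 0 ∧
      x₀₁ < x₀₂ ∧
      (∀ x ∈ Set.Ioo (0 : ℝ) (Λ₀ / (1 + η)), Hfun p Λ₀ γ η 2 x = 0 → x = x₀₁ ∨ x = x₀₂)) ∧
    (1 < Λ₀ / γ →
      x₀₂ ∈ Set.Ioo (0 : ℝ) (Λ₀ / (1 + η)) ∧ Hfun p Λ₀ γ η 2 x₀₂ = 0 ∧
      (∀ x ∈ Set.Ioo (0 : ℝ) (Λ₀ / (1 + η)), Hfun p Λ₀ γ η 2 x = 0 → x = x₀₂)) ∧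
    (γ = (1 + η + p * Λ₀) ^ 2 / (4 * p * (1 + η)) → 1 + η < p * Λ₀ →
      (p * Λ₀ - η - 1) / (2 * p * (1 + η)) ∈ Set.Ioc (0 : ℝ) (Λ₀ / (1 + η)) ∧
      Hfun p Λ₀ γ η 2 ((p * Λ₀ - η - 1) / (2 * p * (1 + η))) = 0 ∧
      ∀ x ∈ Set.Ioc (0 : ℝ) (Λ₀ / (1 + η)), Hfun p Λ₀ γ η 2 x = 0 →
        x = (p * Λ₀ - η - 1) / (2 * p * (1 + η))) := by
  have hA : 0 < 2 * p * (1 + η) := by positivity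
  have hη1 : 0 < 1 + η := by linarith
  have hγ : 0 < γ := hη.trans hγη
  have hpΛ : 0 < p * Λ₀ := by positivity
  have hH := fun x => Hfun_two_iff p Λ₀ γ η Δ x hp hΛ hη hΔ
  have h1 : 2 * p * (1 + η) * x₀₁ = p * Λ₀ - η - 1 - Real.sqrt Δ := by
    rw [hx₀₁]; field_simp
  have h2 : 2 * p * (1 + η) * x₀₂ = p * Λ₀ - η - 1 + Real.sqrt Δ := by
    rw [hx₀₂]; field_simp
  have hΔ' : Δ = (1 + η + p * Λ₀) ^ 2 - 4 * p * (1 + η) * γ := by rw [hΔ]; ring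
  have hs0 := Real.sqrt_nonneg Δ
  have hs : Real.sqrt Δ < 1 + η + p * Λ₀ := by
    rw [Real.sqrt_lt' (by positivity), hΔ']
    have : 0 < 4 * p * (1 + η) * γ := by positivity
    linarith
  have hpos : ∀ x, 0 < 2 * p * (1 + η) * x → 0 < x := fun x h => pos_of_mul_pos_right h hA.le
  have hlt : ∀ x, 2 * p * (1 + η) * x < 2 * (p * Λ₀) → x < Λ₀ / (1 + η) := by
    intro x h
    rw [lt_div_iff₀ hη1]
    have : (2 * p) * (x * (1 + η)) < (2 * p) * Λ₀ := by linarith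
    exact lt_of_mul_lt_mul_left this (by positivity)
  have hroot : 0 ≤ Δ → ∀ x, (2 * p * (1 + η) * x - (p * Λ₀ - η - 1)) ^ 2 = Δ →
      x = x₀₁ ∨ x = x₀₂ := by
    intro h0 x hx
    rw [← Real.sq_sqrt h0, sq_eq_sq_iff_eq_or_eq_neg] at hx
    rcases hx with hx | hx
    · right
      exact mul_left_cancel₀ hA.ne' (by linarith)
    · left
      exact mul_left_cancel₀ hA.ne' (by linarith)
  have hz1 : 0 ≤ Δ → Hfun p Λ₀ γ η 2 x₀₁ = 0 := by
    intro h0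
    rw [hH, h1]
    nlinarith [Real.sq_sqrt h0]
  have hz2 : 0 ≤ Δ → Hfun p Λ₀ γ η 2 x₀₂ = 0 := by
    intro h0
    rw [hH, h2]
    nlinarith [Real.sq_sqrt h0]
  refine ⟨?_, ?_, ?_⟩
  · intro hR hpp hg
    rw [div_lt_one hγ] at hR
    rw [div_lt_iff₀ hΛ] at hpp
    rw [lt_div_iff₀ (by positivity)] at hg
    have hD : 0 < Δ := by rw [hΔ']; linarith
    have hsB : Real.sqrt Δ < p * Λ₀ - η - 1 := by
      rw [Real.sqrt_lt' (by linarith), hΔ]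
      have : 0 < 4 * p * (1 + η) * (γ - Λ₀) := mul_pos (by positivity) (by linarith)
      linarith
    have hsp := Real.sqrt_pos.2 hD
    refine ⟨hD, ⟨hpos _ (by linarith), hlt _ (by linarith)⟩, hz1 hD.le,
      ⟨hpos _ (by linarith), hlt _ (by linarith)⟩, hz2 hD.le, ?_, ?_⟩
    · exact lt_of_mul_lt_mul_left (by linarith) hA.le
    · intro x _ hx
      exact hroot hD.le x ((hH x).1 hx)
  · intro hR
    rw [one_lt_div hγ] at hR
    have hq : 0 < 4 * p * (1 + η) * (Λ₀ - γ) := mul_pos (by positivity) (by linarith)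
    have hBD : (p * Λ₀ - η - 1) ^ 2 < Δ := by rw [hΔ]; linarith
    have hD : 0 < Δ := lt_of_le_of_lt (sq_nonneg _) hBD
    have habs := abs_lt.1 ((Real.lt_sqrt (abs_nonneg _)).2 ((sq_abs _).trans_lt hBD))
    refine ⟨⟨hpos _ (by linarith [habs.1]), hlt _ (by linarith)⟩, hz2 hD.le, ?_⟩
    intro x hx hx0
    rcases hroot hD.le x ((hH x).1 hx0) with h | h
    · exfalso
      have : 0 < 2 * p * (1 + η) * x := mul_pos hA hx.1
      rw [h] at this
      linarith [habs.2]
    · exact h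
  · intro hg hB
    rw [eq_div_iff (by positivity)] at hg
    have hD : Δ = 0 := by rw [hΔ']; linarith
    have hs00 : Real.sqrt Δ = 0 := by rw [hD, Real.sqrt_zero]
    rw [hs00, sub_zero] at hx₀₁
    rw [hs00, add_zero] at hx₀₂
    rw [← hx₀₂]
    refine ⟨⟨hpos _ (by linarith), (hlt _ (by linarith)).le⟩, hz2 hD.ge, ?_⟩
    intro x _ hx
    rcases hroot hD.ge x ((hH x).1 hx) with h | h
    · rw [h, hx₀₁, hx₀₂]
    · exact h
end

section
/- Assume k > 2. Then H has at most three zeros in (0, Λ₀/(1+η)]; equivalently, system (★) has at most three positive equilibria. -/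
/-- Rolle on the positive half-line. -/
theorem rolle_pos (f f' : ℝ → ℝ) (hf : ∀ x, 0 < x → HasDerivAt f (f' x) x)
    (a b : ℝ) (ha : 0 < a) (hab : a < b) (h0 : f a = 0) (h1 : f b = 0) :
    ∃ c, a < c ∧ c < b ∧ f' c = 0 := by
  obtain ⟨c, hc, h⟩ := exists_hasDerivAt_eq_zero (f := f) (f' := f') hab
    (fun x hx => (hf x (lt_of_lt_of_le ha hx.1)).continuousAt.continuousWithinAt)
    (h0.trans h1.symm) (fun x hx => hf x (ha.trans hx.1))
  exact ⟨c, hc.1, hc.2, h⟩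

theorem Hfun_no_four (p Λ₀ γ η k : ℝ)
    (hp : 0 < p) (hΛ : 0 < Λ₀) (hη : 0 < η) (hk : 2 < k)
    (a b c d : ℝ) (ha : 0 < a) (hab : a < b) (hbc : b < c) (hcd : c < d)
    (h1 : Hfun p Λ₀ γ η k a = 0) (h2 : Hfun p Λ₀ γ η k b = 0)
    (h3 : Hfun p Λ₀ γ η k c = 0) (h4 : Hfun p Λ₀ γ η k d = 0) : False := by
  have hlin : ∀ x : ℝ, HasDerivAt (fun x : ℝ => 1 - (1 + η) * x / Λ₀) (-((1 + η) / Λ₀)) x := by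
    intro x
    have := ((((hasDerivAt_id x).const_mul (1 + η)).div_const Λ₀).const_sub 1)
    simpa using this
  have hpow : ∀ r x : ℝ, 0 < x → HasDerivAt (fun x : ℝ => x ^ r) (r * x ^ (r - 1)) x :=
    fun r x hx => Real.hasDerivAt_rpow_const (Or.inl hx.ne')
  let G : ℝ → ℝ := fun x => p * ((k - 1) * x ^ (k - 1 - 1)) * (1 - (1 + η) * x / Λ₀)
    + (1 + p * x ^ (k - 1)) * (-((1 + η) / Λ₀))
  let K : ℝ → ℝ := fun x =>
    (p * ((k - 1) * ((k - 1 - 1) * x ^ (k - 1 - 1 - 1))) * (1 - (1 + η) * x / Λ₀)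
      + p * ((k - 1) * x ^ (k - 1 - 1)) * (-((1 + η) / Λ₀)))
    + p * ((k - 1) * x ^ (k - 1 - 1)) * (-((1 + η) / Λ₀))
  have hG : ∀ x, 0 < x → HasDerivAt (Hfun p Λ₀ γ η k) (G x) x := by
    intro x hx
    exact (((((hpow (k - 1) x hx).const_mul p).const_add 1).mul (hlin x)).sub_const (γ / Λ₀))
  have hK : ∀ x, 0 < x → HasDerivAt G (K x) x := by
    intro x hx
    exact (((((hpow (k - 1 - 1) x hx).const_mul (k - 1)).const_mul p).mul (hlin x)).add
      ((((hpow (k - 1) x hx).const_mul p).const_add 1).mul_const _))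
  have hz : ∀ x, 0 < x → K x = 0 → x * ((1 + η) / Λ₀ * k) = k - 2 := by
    intro x hx h
    have e : x ^ (k - 1 - 1) = x ^ (k - 1 - 1 - 1) * x := by
      rw [← Real.rpow_add_one hx.ne']; congr 1; ring
    have h' : (p * (k - 1) * x ^ (k - 1 - 1 - 1)) * (k - 2 - x * ((1 + η) / Λ₀ * k)) = 0 := by
      rw [← h]; simp only [K]; rw [e]; ring
    have hpos : 0 < p * (k - 1) * x ^ (k - 1 - 1 - 1) :=
      mul_pos (mul_pos hp (by linarith)) (Real.rpow_pos_of_pos hx _)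
    rcases mul_eq_zero.mp h' with h'' | h''
    · exact absurd h'' hpos.ne'
    · linarith
  obtain ⟨u, hu1, hu2, hu⟩ := rolle_pos _ _ hG a b ha hab h1 h2
  obtain ⟨v, hv1, hv2, hv⟩ := rolle_pos _ _ hG b c (by linarith) hbc h2 h3
  obtain ⟨w, hw1, hw2, hw⟩ := rolle_pos _ _ hG c d (by linarith) hcd h3 h4
  obtain ⟨s, hs1, hs2, hs⟩ := rolle_pos _ _ hK u v (by linarith) (by linarith) hu hv
  obtain ⟨t, ht1, ht2, ht⟩ := rolle_pos _ _ hK v w (by linarith) (by linarith) hv hw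
  have e1 := hz s (by linarith) hs
  have e2 := hz t (by linarith) ht
  have hc : 0 < (1 + η) / Λ₀ * k := by
    have : 0 < k := by linarith
    positivity
  have := mul_right_cancel₀ hc.ne' (e1.trans e2.symm)
  linarith

/-- For `k > 2`, `H` has at most three zeros in `(0, Λ₀/(1+η)]`;
equivalently, system (★) has at most three positive equilibria. -/
theorem at_most_three_positive_equilibria_of_k_gt_two
    (p Λ₀ γ η k : ℝ)
    (hp : 0 < p) (hΛ : 0 < Λ₀) (hη : 0 < η) (hγη : η < γ) (hk : 2 < k) :
    {x ∈ Set.Ioc (0 : ℝ) (Λ₀ / (1 + η)) | Hfun p Λ₀ γ η k x = 0}.encard ≤ 3 ∧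
    {q : ℝ × ℝ | 0 < q.1 ∧ starVF p Λ₀ γ η k q = (0, 0)}.encard ≤ 3 := by
  have key : {x ∈ Set.Ioc (0 : ℝ) (Λ₀ / (1 + η)) | Hfun p Λ₀ γ η k x = 0}.encard ≤ 3 := by
    by_contra hcon
    have h4 : (4 : ℕ∞) ≤ {x ∈ Set.Ioc (0 : ℝ) (Λ₀ / (1 + η)) | Hfun p Λ₀ γ η k x = 0}.encard := by
      have := Order.add_one_le_of_lt (not_le.mp hcon)
      have e : (3 : ℕ∞) + 1 = 4 := by norm_num
      rwa [e] at this
    obtain ⟨T, hT, hTc⟩ := Set.exists_subset_encard_eq h4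
    have hfin : T.Finite := Set.finite_of_encard_eq_coe (k := 4) (by simpa using hTc)
    lift T to Finset ℝ using hfin
    have hc : T.card = 4 := by
      rw [Set.encard_coe_eq_coe_finsetCard] at hTc
      exact_mod_cast hTc
    let f := T.orderEmbOfFin hc
    have hm : ∀ i, f i ∈ {x ∈ Set.Ioc (0 : ℝ) (Λ₀ / (1 + η)) | Hfun p Λ₀ γ η k x = 0} :=
      fun i => hT (Finset.mem_coe.mpr (T.orderEmbOfFin_mem hc i))
    exact Hfun_no_four p Λ₀ γ η k hp hΛ hη hk (f 0) (f 1) (f 2) (f 3) (hm 0).1.1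
      (f.strictMono (by decide)) (f.strictMono (by decide)) (f.strictMono (by decide))
      (hm 0).2 (hm 1).2 (hm 2).2 (hm 3).2
  refine ⟨key, le_trans ?_ key⟩
  apply Set.encard_le_encard_of_injOn (f := Prod.fst)
  · rintro ⟨x, y⟩ ⟨hx, hq⟩
    simp only [starVF, Prod.mk.injEq] at hq hx
    obtain ⟨h1, h2⟩ := hq
    have hy : y = η * x := by linarith
    subst hy
    have h3 : (1 + p * x ^ (k - 1)) * (Λ₀ - (1 + η) * x) = γ := by
      apply mul_left_cancel₀ hx.ne'
      linarith
    have hpos : 0 < 1 + p * x ^ (k - 1) := by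
      have := Real.rpow_pos_of_pos hx (k - 1)
      positivity
    have h5 : 0 < Λ₀ - (1 + η) * x := by
      apply pos_of_mul_pos_right _ hpos.le
      rw [h3]; linarith
    refine ⟨⟨hx, ?_⟩, ?_⟩
    · show x ≤ _
      rw [le_div_iff₀ (by linarith)]
      linarith
    · show Hfun p Λ₀ γ η k x = 0
      rw [Hfun, ← h3]
      field_simp
      ring
  · rintro ⟨x, y⟩ ⟨hx, hq⟩ ⟨x', y'⟩ ⟨hx', hq'⟩ h
    simp only [starVF, Prod.mk.injEq] at hq hq' h ⊢
    subst h
    exact ⟨rfl, by linarith [hq.2, hq'.2]⟩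
end

section
/- Assume k > 2, let x̄_c = Λ₀·(k−2)/(k·(1+η)), suppose H'(x̄_c) > 0 with x₀₁ < x₀₂ the two zeros of H' in (0, Λ₀/(1+η)), and suppose R₀ > 1, H(x₀₁) < 0 and H(x₀₂) > 0. Then H has exactly three zeros x̄₃* < x̄₄* < x̄₅* in (0, Λ₀/(1+η)), with x̄₃* ∈ (0, x₀₁), x̄₄* ∈ (x₀₁, x₀₂), x̄₅* ∈ (x₀₂, Λ₀/(1+η)), and H'(x̄₃*) < 0, H'(x̄₄*) > 0, H'(x̄₅*) < 0. -/
theorem aux_up (f : ℝ → ℝ) (hf : Differentiable ℝ f) (a b : ℝ) (hab : a < b)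
    (hne : ∀ x ∈ Set.Ioo a b, deriv f x ≠ 0) (ha : f a < 0) (hb : 0 < f b) :
    ∃ c ∈ Set.Ioo a b, f c = 0 ∧ 0 < deriv f c ∧ ∀ x ∈ Set.Ioo a b, f x = 0 → x = c := by
  obtain ⟨d, hd, hd'⟩ := exists_deriv_eq_slope f hab hf.continuous.continuousOn
    hf.differentiableOn
  have hdpos : 0 < deriv f d := by
    rw [hd']
    exact div_pos (by linarith) (by linarith)
  have hpos : ∀ x ∈ Set.Ioo a b, 0 < deriv f x := by
    rcases hasDerivWithinAt_forall_lt_or_forall_gt_of_forall_ne (f := f) (f' := deriv f)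
      (convex_Ioo a b) (fun x _ => (hf x).hasDerivAt.hasDerivWithinAt) hne with h | h
    · exact absurd (h d hd) (not_lt.2 hdpos.le)
    · exact h
  have hmono : StrictMonoOn f (Set.Icc a b) := by
    apply strictMonoOn_of_deriv_pos (convex_Icc a b) hf.continuous.continuousOn
    rw [interior_Icc]
    exact hpos
  obtain ⟨c, hc, hc0⟩ := intermediate_value_Ioo hab.le hf.continuous.continuousOn
    (show (0 : ℝ) ∈ Set.Ioo (f a) (f b) from ⟨ha, hb⟩)
  exact ⟨c, hc, hc0, hpos c hc, fun x hx h0 => hmono.injOn (Set.Ioo_subset_Icc_self hx)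
    (Set.Ioo_subset_Icc_self hc) (h0.trans hc0.symm)⟩

theorem aux_down (f : ℝ → ℝ) (hf : Differentiable ℝ f) (a b : ℝ) (hab : a < b)
    (hne : ∀ x ∈ Set.Ioo a b, deriv f x ≠ 0) (ha : 0 < f a) (hb : f b < 0) :
    ∃ c ∈ Set.Ioo a b, f c = 0 ∧ deriv f c < 0 ∧ ∀ x ∈ Set.Ioo a b, f x = 0 → x = c := by
  have hd : ∀ x, deriv (fun y => -f y) x = -deriv f x := fun x => deriv.fun_neg
  obtain ⟨c, hc, h0, h1, h2⟩ := aux_up (fun y => -f y) hf.fun_neg a b hab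
    (fun x hx => by rw [hd]; exact neg_ne_zero.2 (hne x hx)) (by linarith) (by linarith)
  rw [hd] at h1
  exact ⟨c, hc, by linarith, by linarith, fun x hx h => h2 x hx (by simp [h])⟩

theorem Hfun_differentiable (p Λ₀ γ η k : ℝ) (hk : 2 < k) :
    Differentiable ℝ (Hfun p Λ₀ γ η k) := by
  have h : Differentiable ℝ (fun x : ℝ => x ^ (k - 1)) :=
    fun x => (Real.hasDerivAt_rpow_const (Or.inr (by linarith))).differentiableAt
  unfold Hfun
  fun_prop

/-- For `k > 2`, `x̄_c = Λ₀(k−2)/(k(1+η))`, `H'(x̄_c) > 0`, `x₀₁ < x₀₂`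
the two zeros of `H'` in `(0, Λ₀/(1+η))`, and `R₀ > 1`, `H(x₀₁) < 0 < H(x₀₂)`: then `H` has
exactly three zeros `x̄₃* < x̄₄* < x̄₅*` in `(0, Λ₀/(1+η))`, lying in `(0, x₀₁)`,
`(x₀₁, x₀₂)`, `(x₀₂, Λ₀/(1+η))` respectively, with `H'(x̄₃*) < 0`, `H'(x̄₄*) > 0`,
`H'(x̄₅*) < 0`. -/
theorem three_zeros_of_k_gt_two
    (p Λ₀ γ η k xc x₀₁ x₀₂ : ℝ)
    (hp : 0 < p) (hΛ : 0 < Λ₀) (hη : 0 < η) (hγη : η < γ) (hk : 2 < k)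
    (hxcdef : xc = Λ₀ * (k - 2) / (k * (1 + η)))
    (hHxc : 0 < deriv (Hfun p Λ₀ γ η k) xc)
    (hx₀₁ : x₀₁ ∈ Set.Ioo (0 : ℝ) (Λ₀ / (1 + η)))
    (hx₀₂ : x₀₂ ∈ Set.Ioo (0 : ℝ) (Λ₀ / (1 + η)))
    (hlt : x₀₁ < x₀₂)
    (hz₁ : deriv (Hfun p Λ₀ γ η k) x₀₁ = 0)
    (hz₂ : deriv (Hfun p Λ₀ γ η k) x₀₂ = 0)
    (huniq : ∀ x ∈ Set.Ioo (0 : ℝ) (Λ₀ / (1 + η)),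
      deriv (Hfun p Λ₀ γ η k) x = 0 → x = x₀₁ ∨ x = x₀₂)
    (hR₀ : 1 < Λ₀ / γ)
    (hH₁ : Hfun p Λ₀ γ η k x₀₁ < 0)
    (hH₂ : 0 < Hfun p Λ₀ γ η k x₀₂) :
    ∃ x₃ x₄ x₅ : ℝ,
      x₃ ∈ Set.Ioo (0 : ℝ) x₀₁ ∧ x₄ ∈ Set.Ioo x₀₁ x₀₂ ∧ x₅ ∈ Set.Ioo x₀₂ (Λ₀ / (1 + η)) ∧
      x₃ < x₄ ∧ x₄ < x₅ ∧
      Hfun p Λ₀ γ η k x₃ = 0 ∧ Hfun p Λ₀ γ η k x₄ = 0 ∧ Hfun p Λ₀ γ η k x₅ = 0 ∧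
      deriv (Hfun p Λ₀ γ η k) x₃ < 0 ∧ 0 < deriv (Hfun p Λ₀ γ η k) x₄ ∧
      deriv (Hfun p Λ₀ γ η k) x₅ < 0 ∧
      (∀ x ∈ Set.Ioo (0 : ℝ) (Λ₀ / (1 + η)),
        Hfun p Λ₀ γ η k x = 0 → x = x₃ ∨ x = x₄ ∨ x = x₅) := by
  have hγ : 0 < γ := hη.trans hγη
  have hD := Hfun_differentiable p Λ₀ γ η k hk
  have hγΛ : γ < Λ₀ := by rwa [one_lt_div hγ] at hR₀
  have hA : 0 < Hfun p Λ₀ γ η k 0 := by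
    have : γ / Λ₀ < 1 := (div_lt_one hΛ).2 hγΛ
    unfold Hfun
    rw [Real.zero_rpow (by linarith)]
    simp only [mul_zero, add_zero, zero_div, sub_zero, mul_one]
    linarith
  have hB : Hfun p Λ₀ γ η k (Λ₀ / (1 + η)) < 0 := by
    have h1 : (1 + η) * (Λ₀ / (1 + η)) / Λ₀ = 1 := by
      have : 1 + η ≠ 0 := by positivity
      field_simp
    have : 0 < γ / Λ₀ := by positivity
    unfold Hfun
    rw [h1]
    linarith
  obtain ⟨h1, h1'⟩ := hx₀₁
  obtain ⟨h2, h2'⟩ := hx₀₂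
  obtain ⟨x₃, ⟨a3, b3⟩, c3, d3, e3⟩ := aux_down _ hD 0 x₀₁ h1 (by
    rintro x ⟨hx, hx'⟩ h
    rcases huniq x ⟨hx, by linarith⟩ h with h | h <;> linarith) hA hH₁
  obtain ⟨x₄, ⟨a4, b4⟩, c4, d4, e4⟩ := aux_up _ hD x₀₁ x₀₂ hlt (by
    rintro x ⟨hx, hx'⟩ h
    rcases huniq x ⟨by linarith, by linarith⟩ h with h | h <;> linarith) hH₁ hH₂
  obtain ⟨x₅, ⟨a5, b5⟩, c5, d5, e5⟩ := aux_down _ hD x₀₂ _ h2' (by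
    rintro x ⟨hx, hx'⟩ h
    rcases huniq x ⟨by linarith, by linarith⟩ h with h | h <;> linarith) hH₂ hB
  refine ⟨x₃, x₄, x₅, ⟨a3, b3⟩, ⟨a4, b4⟩, ⟨a5, b5⟩, by linarith, by linarith, c3, c4, c5,
    d3, d4, d5, ?_⟩
  rintro x ⟨hx, hx'⟩ h
  rcases lt_trichotomy x x₀₁ with g | g | g
  · exact Or.inl (e3 x ⟨hx, g⟩ h)
  · rw [g] at h
    linarith
  · rcases lt_trichotomy x x₀₂ with g' | g' | g'
    · exact Or.inr (Or.inl (e4 x ⟨g, g'⟩ h))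
    · rw [g'] at h
      linarith
    · exact Or.inr (Or.inr (e5 x ⟨g', hx'⟩ h))
end

section
/- Assume k > 2, let x̄_c = Λ₀·(k−2)/(k·(1+η)), suppose H'(x̄_c) > 0 with x₀₁ < x₀₂ the two zeros of H' in (0, Λ₀/(1+η)), and suppose R₀ ≤ 1 and H(x₀₂) > 0. Then H(x₀₁) < 1 − γ/Λ₀ ≤ 0 and H has exactly two zeros x̂₁* < x̂₂* in (0, Λ₀/(1+η)), with x̂₁* ∈ (x₀₁, x₀₂) and x̂₂* ∈ (x₀₂, Λ₀/(1+η)), and H'(x̂₁*) > 0, H'(x̂₂*) < 0. -/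
/-- A continuous function without zeros between `a` and `b` keeps its sign. -/
theorem aux_sign {g : ℝ → ℝ} (hg : Continuous g) {a b : ℝ} (ha : g a < 0)
    (hn : ∀ z ∈ Set.uIcc a b, g z ≠ 0) : g b < 0 := by
  by_contra hb
  push Not at hb
  have h := intermediate_value_uIcc (hg.continuousOn (s := Set.uIcc a b))
  have h0 : (0:ℝ) ∈ Set.uIcc (g a) (g b) := Set.mem_uIcc.2 (Or.inl ⟨ha.le, hb⟩)
  obtain ⟨z, hz, hz0⟩ := h h0
  exact hn z hz hz0

theorem aux_sign_pos {g : ℝ → ℝ} (hg : Continuous g) {a b : ℝ} (ha : 0 < g a)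
    (hn : ∀ z ∈ Set.uIcc a b, g z ≠ 0) : 0 < g b := by
  have := aux_sign (g := fun x => - g x) hg.neg (a := a) (b := b) (by simpa using ha)
    (fun z hz => by simpa using hn z hz)
  simpa using this

theorem aux_main {f : ℝ → ℝ} {B c u v : ℝ} (hf : Differentiable ℝ f)
    (hg : Continuous (deriv f)) (hc : c ∈ Set.Ioo 0 B) (hc0 : 0 < deriv f c)
    (h0 : deriv f 0 < 0) (hB : deriv f B < 0)
    (hu : u ∈ Set.Ioo 0 B) (hv : v ∈ Set.Ioo 0 B) (huv : u < v)
    (hu0 : deriv f u = 0) (hv0 : deriv f v = 0)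
    (huniq : ∀ x ∈ Set.Ioo 0 B, deriv f x = 0 → x = u ∨ x = v)
    (hf0 : f 0 ≤ 0) (hfB : f B < 0) (hfv : 0 < f v) :
    f u < f 0 ∧ ∃ x₁ x₂ : ℝ, x₁ ∈ Set.Ioo u v ∧ x₂ ∈ Set.Ioo v B ∧ x₁ < x₂ ∧
      f x₁ = 0 ∧ f x₂ = 0 ∧ 0 < deriv f x₁ ∧ deriv f x₂ < 0 ∧
      (∀ x ∈ Set.Ioo 0 B, f x = 0 → x = x₁ ∨ x = x₂) := by
  obtain ⟨hu1, hu2⟩ := hu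
  obtain ⟨hv1, hv2⟩ := hv
  obtain ⟨hc1, hc2⟩ := hc
  obtain ⟨z, hz, hz0⟩ := intermediate_value_Ioo hc1.le hg.continuousOn ⟨h0, hc0⟩
  obtain ⟨w, hw, hw0⟩ := intermediate_value_Ioo' hc2.le hg.continuousOn ⟨hB, hc0⟩
  have hz' := huniq z ⟨hz.1, hz.2.trans hc2⟩ hz0
  have hw' := huniq w ⟨hc1.trans hw.1, hw.2⟩ hw0
  have huc : u < c := by
    rcases hz' with h | h
    · rw [← h]; exact hz.2
    · have := hz.2
      linarith
  have hcv : c < v := by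
    rcases hw' with h | h
    · have := hw.1
      linarith
    · rw [← h]; exact hw.1
  have s1 : ∀ x ∈ Set.Ioo 0 u, deriv f x < 0 := by
    rintro x ⟨hx1, hx2⟩
    refine aux_sign hg h0 fun t ht h => ?_
    rw [Set.uIcc_of_le hx1.le] at ht
    rcases ht.1.eq_or_lt with e | e
    · rw [← e] at h; linarith
    · rcases huniq t ⟨e, by linarith [ht.2]⟩ h with r | r <;> linarith [ht.2]
  have s2 : ∀ x ∈ Set.Ioo u v, 0 < deriv f x := by
    rintro x ⟨hx1, hx2⟩
    refine aux_sign_pos hg hc0 fun t ht h => ?_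
    have ht1 : u < t := by
      rcases Set.mem_uIcc.1 ht with r | r <;> linarith [r.1]
    have ht2 : t < v := by
      rcases Set.mem_uIcc.1 ht with r | r <;> linarith [r.2]
    rcases huniq t ⟨by linarith, by linarith⟩ h with r | r <;> linarith
  have s3 : ∀ x ∈ Set.Ioo v B, deriv f x < 0 := by
    rintro x ⟨hx1, hx2⟩
    refine aux_sign hg hB fun t ht h => ?_
    rw [Set.uIcc_of_ge hx2.le] at ht
    rcases ht.2.eq_or_lt with e | e
    · rw [e] at h; linarith
    · rcases huniq t ⟨by linarith [ht.1], e⟩ h with r | r <;> linarith [ht.1]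
  have m1 : StrictAntiOn f (Set.Icc 0 u) :=
    strictAntiOn_of_deriv_neg (convex_Icc _ _) hf.continuous.continuousOn
      (by rw [interior_Icc]; exact s1)
  have m2 : StrictMonoOn f (Set.Icc u v) :=
    strictMonoOn_of_deriv_pos (convex_Icc _ _) hf.continuous.continuousOn
      (by rw [interior_Icc]; exact s2)
  have m3 : StrictAntiOn f (Set.Icc v B) :=
    strictAntiOn_of_deriv_neg (convex_Icc _ _) hf.continuous.continuousOn
      (by rw [interior_Icc]; exact s3)
  have hfu : f u < f 0 := m1 ⟨le_rfl, hu1.le⟩ ⟨hu1.le, le_rfl⟩ hu1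
  obtain ⟨x₁, h1, h1z⟩ := intermediate_value_Ioo huv.le hf.continuous.continuousOn
    (show (0:ℝ) ∈ Set.Ioo (f u) (f v) from ⟨by linarith, hfv⟩)
  obtain ⟨x₂, h2, h2z⟩ := intermediate_value_Ioo' hv2.le hf.continuous.continuousOn
    (show (0:ℝ) ∈ Set.Ioo (f B) (f v) from ⟨hfB, hfv⟩)
  refine ⟨hfu, x₁, x₂, h1, h2, h1.2.trans h2.1, h1z, h2z, s2 _ h1, s3 _ h2, ?_⟩
  rintro x ⟨hx1, hx2⟩ hx
  rcases le_total x u with a | a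
  · have := m1 ⟨le_rfl, hu1.le⟩ ⟨hx1.le, a⟩ hx1
    linarith
  · rcases le_total x v with b | b
    · exact Or.inl (m2.injOn ⟨a, b⟩ ⟨h1.1.le, h1.2.le⟩ (hx.trans h1z.symm))
    · exact Or.inr (m3.injOn ⟨b, hx2.le⟩ ⟨h2.1.le, h2.2.le⟩ (hx.trans h2z.symm))

theorem aux_deriv (p Λ₀ γ η k : ℝ) (hk : 2 < k) (x : ℝ) :
    HasDerivAt (Hfun p Λ₀ γ η k)
      (p * ((k - 1) * x ^ (k - 1 - 1)) * (1 - (1 + η) * x / Λ₀)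
        + (1 + p * x ^ (k - 1)) * (-((1 + η) * 1 / Λ₀))) x := by
  have h1 : HasDerivAt (fun x : ℝ => 1 + p * x ^ (k - 1)) (p * ((k - 1) * x ^ (k - 1 - 1))) x :=
    ((Real.hasDerivAt_rpow_const (Or.inr (by linarith))).const_mul p).const_add 1
  have h2 : HasDerivAt (fun x : ℝ => 1 - (1 + η) * x / Λ₀) (-((1 + η) * 1 / Λ₀)) x :=
    (((hasDerivAt_id x).const_mul (1 + η)).div_const Λ₀).const_sub 1
  exact (h1.mul h2).sub_const _

/-- For `k > 2`, `x̄_c = Λ₀(k−2)/(k(1+η))`, `H'(x̄_c) > 0`, `x₀₁ < x₀₂`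
the two zeros of `H'` in `(0, Λ₀/(1+η))`, and `R₀ ≤ 1`, `H(x₀₂) > 0`: then
`H(x₀₁) < 1 − γ/Λ₀ ≤ 0` and `H` has exactly two zeros `x̂₁* < x̂₂*` in `(0, Λ₀/(1+η))`,
with `x̂₁* ∈ (x₀₁, x₀₂)`, `x̂₂* ∈ (x₀₂, Λ₀/(1+η))`, `H'(x̂₁*) > 0`, `H'(x̂₂*) < 0`. -/
theorem two_zeros_of_k_gt_two_R0_le_one
    (p Λ₀ γ η k xc x₀₁ x₀₂ : ℝ)
    (hp : 0 < p) (hΛ : 0 < Λ₀) (hη : 0 < η) (hγη : η < γ) (hk : 2 < k)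
    (hxcdef : xc = Λ₀ * (k - 2) / (k * (1 + η)))
    (hHxc : 0 < deriv (Hfun p Λ₀ γ η k) xc)
    (hx₀₁ : x₀₁ ∈ Set.Ioo (0 : ℝ) (Λ₀ / (1 + η)))
    (hx₀₂ : x₀₂ ∈ Set.Ioo (0 : ℝ) (Λ₀ / (1 + η)))
    (hlt : x₀₁ < x₀₂)
    (hz₁ : deriv (Hfun p Λ₀ γ η k) x₀₁ = 0)
    (hz₂ : deriv (Hfun p Λ₀ γ η k) x₀₂ = 0)
    (huniq : ∀ x ∈ Set.Ioo (0 : ℝ) (Λ₀ / (1 + η)),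
      deriv (Hfun p Λ₀ γ η k) x = 0 → x = x₀₁ ∨ x = x₀₂)
    (hR₀ : Λ₀ / γ ≤ 1)
    (hH₂ : 0 < Hfun p Λ₀ γ η k x₀₂) :
    Hfun p Λ₀ γ η k x₀₁ < 1 - γ / Λ₀ ∧ 1 - γ / Λ₀ ≤ 0 ∧
    ∃ x₁ x₂ : ℝ,
      x₁ ∈ Set.Ioo x₀₁ x₀₂ ∧ x₂ ∈ Set.Ioo x₀₂ (Λ₀ / (1 + η)) ∧ x₁ < x₂ ∧
      Hfun p Λ₀ γ η k x₁ = 0 ∧ Hfun p Λ₀ γ η k x₂ = 0 ∧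
      0 < deriv (Hfun p Λ₀ γ η k) x₁ ∧ deriv (Hfun p Λ₀ γ η k) x₂ < 0 ∧
      (∀ x ∈ Set.Ioo (0 : ℝ) (Λ₀ / (1 + η)), Hfun p Λ₀ γ η k x = 0 → x = x₁ ∨ x = x₂) := by
  have hγ : 0 < γ := hη.trans hγη
  have hd := aux_deriv p Λ₀ γ η k hk
  have hde : deriv (Hfun p Λ₀ γ η k) = fun x => (p * ((k - 1) * x ^ (k - 1 - 1)) *
      (1 - (1 + η) * x / Λ₀) + (1 + p * x ^ (k - 1)) * (-((1 + η) * 1 / Λ₀))) :=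
    funext fun x => (hd x).deriv
  have hc : 0 < (1 + η) * 1 / Λ₀ := by positivity
  have hB1 : 1 - (1 + η) * (Λ₀ / (1 + η)) / Λ₀ = 0 := by
    field_simp
    ring
  have hle : 1 - γ / Λ₀ ≤ 0 := by
    rw [div_le_one hγ] at hR₀
    have := (one_le_div hΛ).2 hR₀
    linarith
  have hf0 : Hfun p Λ₀ γ η k 0 = 1 - γ / Λ₀ := by
    simp [Hfun, Real.zero_rpow (show k - 1 ≠ 0 by linarith)]
  have key := aux_main (f := Hfun p Λ₀ γ η k) (B := Λ₀ / (1 + η)) (c := xc) (u := x₀₁) (v := x₀₂)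
    (fun x => (hd x).differentiableAt)
    (by
      rw [hde]
      have r1 : Continuous fun x : ℝ => x ^ (k - 1 - 1) :=
        Real.continuous_rpow_const (by linarith)
      have r2 : Continuous fun x : ℝ => x ^ (k - 1) :=
        Real.continuous_rpow_const (by linarith)
      fun_prop)
    (by
      rw [hxcdef]
      constructor
      · have : 0 < k - 2 := by linarith
        positivity
      · rw [div_lt_div_iff₀ (by positivity) (by positivity)]
        have : 0 < Λ₀ * (1 + η) := by positivity
        nlinarith)
    hHxc
    (by
      rw [hde]
      simp only [Real.zero_rpow (show k - 1 ≠ 0 by linarith),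
        Real.zero_rpow (show k - 1 - 1 ≠ 0 by linarith)]
      simp only [mul_zero, zero_mul, zero_add, add_zero, one_mul]
      linarith)
    (by
      rw [hde]
      simp only [hB1, mul_zero, zero_add]
      have : 0 < 1 + p * (Λ₀ / (1 + η)) ^ (k - 1) := by positivity
      nlinarith [mul_pos this hc])
    hx₀₁ hx₀₂ hlt hz₁ hz₂ huniq (hf0.trans_le hle)
    (by
      simp only [Hfun, hB1, mul_zero, zero_sub]
      have : 0 < γ / Λ₀ := by positivity
      linarith)
    hH₂
  rw [hf0] at key
  exact ⟨key.1, hle, key.2⟩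
end

section
/- Assume k > 2, let x̄_c = Λ₀·(k−2)/(k·(1+η)), suppose H'(x̄_c) > 0 with x₀₁ < x₀₂ the two zeros of H' in (0, Λ₀/(1+η)), and suppose R₀ > 1. Then: (a) if H(x₀₁) > 0, H has exactly one zero in (0, Λ₀/(1+η)), and it lies in (x₀₂, Λ₀/(1+η)); (b) if H(x₀₂) < 0, H has exactly one zero in (0, Λ₀/(1+η)), and it lies in (0, x₀₁). -/
theorem ivt_up (g : ℝ → ℝ) (hg : Continuous g) {u v : ℝ} (huv : u < v) (h1 : g u < 0)
    (h2 : 0 < g v) : ∃ z, u < z ∧ z < v ∧ g z = 0 := by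
  obtain ⟨z, hz, h⟩ := intermediate_value_Ioo huv.le hg.continuousOn ⟨h1, h2⟩
  exact ⟨z, hz.1, hz.2, h⟩

theorem ivt_down (g : ℝ → ℝ) (hg : Continuous g) {u v : ℝ} (huv : u < v) (h1 : 0 < g u)
    (h2 : g v < 0) : ∃ z, u < z ∧ z < v ∧ g z = 0 := by
  obtain ⟨z, hz, h⟩ := intermediate_value_Ioo' huv.le hg.continuousOn ⟨h2, h1⟩
  exact ⟨z, hz.1, hz.2, h⟩

theorem abstract_zeros (f : ℝ → ℝ) (M c a b : ℝ) (hf : Continuous f)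
    (hg : Continuous (deriv f)) (hc0 : 0 < c) (hcM : c < M) (hc : 0 < deriv f c)
    (h0 : deriv f 0 < 0) (hM : deriv f M < 0) (ha : 0 < a) (hab : a < b) (hb : b < M)
    (huniq : ∀ x ∈ Set.Ioo (0 : ℝ) M, deriv f x = 0 → x = a ∨ x = b)
    (hf0 : 0 < f 0) (hfM : f M < 0) :
    (0 < f a → ∃ x₀ ∈ Set.Ioo b M, f x₀ = 0 ∧ ∀ x ∈ Set.Ioo (0 : ℝ) M, f x = 0 → x = x₀) ∧
    (f b < 0 → ∃ x₀ ∈ Set.Ioo (0 : ℝ) a, f x₀ = 0 ∧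
      ∀ x ∈ Set.Ioo (0 : ℝ) M, f x = 0 → x = x₀) := by
  obtain ⟨z1, h1, h2, h3⟩ := ivt_up _ hg hc0 h0 hc
  obtain ⟨z2, h4, h5, h6⟩ := ivt_down _ hg hcM hc hM
  have hz1 := huniq z1 ⟨h1, by linarith⟩ h3
  have hz2 := huniq z2 ⟨by linarith, h5⟩ h6
  have hac : a < c := by rcases hz1 with h | h <;> linarith
  have hcb : c < b := by rcases hz2 with h | h <;> linarith
  have n1 : ∀ x, 0 < x → x < a → deriv f x < 0 := by
    intro x hx hxa
    by_contra! hh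
    rcases hh.eq_or_lt with h | h
    · rcases huniq x ⟨hx, by linarith⟩ h.symm with h | h <;> linarith
    · obtain ⟨z, _, _, e⟩ := ivt_up _ hg hx h0 h
      rcases huniq z ⟨by linarith, by linarith⟩ e with h | h <;> linarith
  have n3 : ∀ x, b < x → x < M → deriv f x < 0 := by
    intro x hx hxa
    by_contra! hh
    rcases hh.eq_or_lt with h | h
    · rcases huniq x ⟨by linarith, by linarith⟩ h.symm with h | h <;> linarith
    · obtain ⟨z, _, _, e⟩ := ivt_down _ hg hxa h hM
      rcases huniq z ⟨by linarith, by linarith⟩ e with h | h <;> linarith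
  have n2 : ∀ x, a < x → x < b → 0 < deriv f x := by
    intro x hx hxa
    by_contra! hh
    rcases hh.eq_or_lt with h | h
    · rcases huniq x ⟨by linarith, by linarith⟩ h with h | h <;> linarith
    · rcases lt_trichotomy x c with hxc | hxc | hxc
      · obtain ⟨z, _, _, e⟩ := ivt_up _ hg hxc h hc
        rcases huniq z ⟨by linarith, by linarith⟩ e with h | h <;> linarith
      · rw [hxc] at h; linarith
      · obtain ⟨z, _, _, e⟩ := ivt_down _ hg hxc hc h
        rcases huniq z ⟨by linarith, by linarith⟩ e with h | h <;> linarith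
  have s1 : StrictAntiOn f (Set.Icc 0 a) :=
    strictAntiOn_of_deriv_neg (convex_Icc _ _) hf.continuousOn (by
      intro x hx; rw [interior_Icc] at hx; exact n1 x hx.1 hx.2)
  have s2 : StrictMonoOn f (Set.Icc a b) :=
    strictMonoOn_of_deriv_pos (convex_Icc _ _) hf.continuousOn (by
      intro x hx; rw [interior_Icc] at hx; exact n2 x hx.1 hx.2)
  have s3 : StrictAntiOn f (Set.Icc b M) :=
    strictAntiOn_of_deriv_neg (convex_Icc _ _) hf.continuousOn (by
      intro x hx; rw [interior_Icc] at hx; exact n3 x hx.1 hx.2)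
  have hfab : f a < f b := s2 ⟨le_rfl, hab.le⟩ ⟨hab.le, le_rfl⟩ hab
  constructor
  · intro hpos
    obtain ⟨z, hz1, hz2, e⟩ := ivt_down f hf hb (hpos.trans hfab) hfM
    refine ⟨z, ⟨hz1, hz2⟩, e, ?_⟩
    intro x hx hfx
    rcases le_total x a with h | h
    · have := s1.antitoneOn ⟨hx.1.le, h⟩ ⟨ha.le, le_rfl⟩ h
      linarith
    rcases le_total x b with h' | h'
    · have := s2.monotoneOn ⟨le_rfl, hab.le⟩ ⟨h, h'⟩ h
      linarith
    · exact s3.injOn ⟨h', hx.2.le⟩ ⟨hz1.le, hz2.le⟩ (hfx.trans e.symm)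
  · intro hneg
    obtain ⟨z, hz1, hz2, e⟩ := ivt_down f hf ha hf0 (hfab.trans hneg)
    refine ⟨z, ⟨hz1, hz2⟩, e, ?_⟩
    intro x hx hfx
    rcases le_total x a with h | h
    · exact s1.injOn ⟨hx.1.le, h⟩ ⟨hz1.le, hz2.le⟩ (hfx.trans e.symm)
    rcases le_total x b with h' | h'
    · have := s2.monotoneOn ⟨h, h'⟩ ⟨hab.le, le_rfl⟩ h'
      linarith
    · have := s3.antitoneOn ⟨le_rfl, hb.le⟩ ⟨h', hx.2.le⟩ h'
      linarith

theorem Hfun_deriv (p Λ₀ γ η k : ℝ) (hk : 2 < k) : deriv (Hfun p Λ₀ γ η k) = fun x =>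
    (p * ((k - 1) * x ^ (k - 2))) * (1 - (1 + η) * x / Λ₀)
      + (1 + p * x ^ (k - 1)) * (-((1 + η) / Λ₀)) := by
  funext x
  have h1 : HasDerivAt (fun x : ℝ => x ^ (k - 1)) ((k - 1) * x ^ (k - 2)) x := by
    have := Real.hasDerivAt_rpow_const (x := x) (p := k - 1) (Or.inr (by linarith))
    rwa [show k - 1 - 1 = k - 2 by ring] at this
  have h2 : HasDerivAt (fun x : ℝ => 1 - (1 + η) * x / Λ₀) (-((1 + η) / Λ₀)) x := by
    have := (((hasDerivAt_id x).const_mul (1 + η)).div_const Λ₀).const_sub 1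
    simpa using this
  have h3 := (((h1.const_mul p).const_add 1).mul h2).sub_const (γ / Λ₀)
  exact h3.deriv

/-- For `k > 2`, `x̄_c = Λ₀(k−2)/(k(1+η))`, `H'(x̄_c) > 0`, `x₀₁ < x₀₂`
the two zeros of `H'` in `(0, Λ₀/(1+η))`, and `R₀ > 1`:
(a) if `H(x₀₁) > 0`, then `H` has exactly one zero in `(0, Λ₀/(1+η))`, lying in
`(x₀₂, Λ₀/(1+η))`;
(b) if `H(x₀₂) < 0`, then `H` has exactly one zero in `(0, Λ₀/(1+η))`, lying in `(0, x₀₁)`. -/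
theorem unique_zero_of_k_gt_two_R0_gt_one
    (p Λ₀ γ η k xc x₀₁ x₀₂ : ℝ)
    (hp : 0 < p) (hΛ : 0 < Λ₀) (hη : 0 < η) (hγη : η < γ) (hk : 2 < k)
    (hxcdef : xc = Λ₀ * (k - 2) / (k * (1 + η)))
    (hHxc : 0 < deriv (Hfun p Λ₀ γ η k) xc)
    (hx₀₁ : x₀₁ ∈ Set.Ioo (0 : ℝ) (Λ₀ / (1 + η)))
    (hx₀₂ : x₀₂ ∈ Set.Ioo (0 : ℝ) (Λ₀ / (1 + η)))
    (hlt : x₀₁ < x₀₂)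
    (hz₁ : deriv (Hfun p Λ₀ γ η k) x₀₁ = 0)
    (hz₂ : deriv (Hfun p Λ₀ γ η k) x₀₂ = 0)
    (huniq : ∀ x ∈ Set.Ioo (0 : ℝ) (Λ₀ / (1 + η)),
      deriv (Hfun p Λ₀ γ η k) x = 0 → x = x₀₁ ∨ x = x₀₂)
    (hR₀ : 1 < Λ₀ / γ) :
    (0 < Hfun p Λ₀ γ η k x₀₁ →
      ∃ x₀ ∈ Set.Ioo x₀₂ (Λ₀ / (1 + η)), Hfun p Λ₀ γ η k x₀ = 0 ∧
        ∀ x ∈ Set.Ioo (0 : ℝ) (Λ₀ / (1 + η)), Hfun p Λ₀ γ η k x = 0 → x = x₀) ∧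
    (Hfun p Λ₀ γ η k x₀₂ < 0 →
      ∃ x₀ ∈ Set.Ioo (0 : ℝ) x₀₁, Hfun p Λ₀ γ η k x₀ = 0 ∧
        ∀ x ∈ Set.Ioo (0 : ℝ) (Λ₀ / (1 + η)), Hfun p Λ₀ γ η k x = 0 → x = x₀) := by
  have hη1 : 0 < 1 + η := by linarith
  have hγ : 0 < γ := by linarith
  have hγΛ : γ / Λ₀ < 1 := by
    rw [one_lt_div hγ] at hR₀
    rwa [div_lt_one hΛ]
  have hc1 : Continuous (fun x : ℝ => x ^ (k - 1)) :=
    Real.continuous_rpow_const (by linarith)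
  have hc2 : Continuous (fun x : ℝ => x ^ (k - 2)) :=
    Real.continuous_rpow_const (by linarith)
  have hd := Hfun_deriv p Λ₀ γ η k hk
  have e0 : (0 : ℝ) ^ (k - 1) = 0 := Real.zero_rpow (by linarith)
  have e0' : (0 : ℝ) ^ (k - 2) = 0 := Real.zero_rpow (by linarith)
  have hMpos : 0 < Λ₀ / (1 + η) := by positivity
  have eM : 1 - (1 + η) * (Λ₀ / (1 + η)) / Λ₀ = 0 := by field_simp; ring
  have hq : 0 < (1 + η) / Λ₀ := by positivity
  have hMk : 0 < (Λ₀ / (1 + η)) ^ (k - 1) := Real.rpow_pos_of_pos hMpos _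
  have hxc : xc = Λ₀ / (1 + η) * ((k - 2) / k) := by
    rw [hxcdef]; field_simp
  have hr : 0 < (k - 2) / k := div_pos (by linarith) (by linarith)
  have hr1 : (k - 2) / k < 1 := by rw [div_lt_one (by linarith)]; linarith
  apply abstract_zeros (Hfun p Λ₀ γ η k) (Λ₀ / (1 + η)) xc x₀₁ x₀₂ _ _ _ _ hHxc _ _
    hx₀₁.1 hlt hx₀₂.2 huniq
  · simp only [Hfun, e0]; simp; exact hγΛ
  · simp only [Hfun, eM]; simp; positivity
  · unfold Hfun; fun_prop
  · rw [hd]; fun_prop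
  · rw [hxc]; positivity
  · rw [hxc]; nlinarith
  · rw [hd]; simp only [e0, e0']; simp; exact hq
  · rw [hd]; simp only [eM]
    have : 0 < (1 + p * (Λ₀ / (1 + η)) ^ (k - 1)) * ((1 + η) / Λ₀) := by positivity
    linarith
end

section
/- Let k > 0 and let (x*, η·x*) with 0 < x* < Λ₀/(1+η) and H(x*) = 0 be a positive equilibrium of system (★). Then the determinant of the Jacobian matrix of the vector field of (★) at (x*, η·x*) equals −Λ₀·x*·H'(x*). In particular, if H'(x*) > 0 then this Jacobian matrix has negative determinant and hence has one positive and one negative real eigenvalue (the equilibrium is a hyperbolic saddle of the linearization). -/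
theorem eig_aux (a b η u : ℝ) (hη : 0 < η) (hu : u * u + u - a * u - a - b * η = 0) :
    Module.End.HasEigenvalue (Matrix.toLin' !![a, b; η, -1]) u := by
  apply Module.End.hasEigenvalue_of_hasEigenvector (x := ![u + 1, η])
  refine ⟨?_, ?_⟩
  · rw [Module.End.mem_eigenspace_iff, Matrix.toLin'_apply]
    ext i
    fin_cases i
    · simp [Matrix.mulVec, dotProduct, Fin.sum_univ_two]
      linarith
    · simp [Matrix.mulVec, dotProduct, Fin.sum_univ_two]
      ring
  · intro h
    have := congrFun h 1
    simp at this
    exact hη.ne' this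

/-- At a positive equilibrium `(x*, η·x*)` of (★) (i.e. `0 < x* <
Λ₀/(1+η)` with `H(x*) = 0`), the Jacobian matrix of the vector field has determinant
`−Λ₀·x*·H'(x*)`; in particular if `H'(x*) > 0` the determinant is negative and the matrix
has one positive and one negative real eigenvalue. -/
theorem jacobian_det_at_positive_equilibrium
    (p Λ₀ γ η k x : ℝ)
    (hp : 0 < p) (hΛ : 0 < Λ₀) (hη : 0 < η) (hγη : η < γ) (hk : 0 < k)
    (hx : x ∈ Set.Ioo (0 : ℝ) (Λ₀ / (1 + η)))
    (hHx : Hfun p Λ₀ γ η k x = 0) :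
    ∃ a b : ℝ,
      HasFDerivAt (starVF p Λ₀ γ η k) (clm2 a b η (-1)) (x, η * x) ∧
      Matrix.det !![a, b; η, -1] = -Λ₀ * x * deriv (Hfun p Λ₀ γ η k) x ∧
      (0 < deriv (Hfun p Λ₀ γ η k) x →
        Matrix.det !![a, b; η, -1] < 0 ∧
        ∃ u v : ℝ, 0 < u ∧ v < 0 ∧
          Module.End.HasEigenvalue (Matrix.toLin' !![a, b; η, -1]) u ∧
          Module.End.HasEigenvalue (Matrix.toLin' !![a, b; η, -1]) v) := by
  obtain ⟨hx0, hx1⟩ := hx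
  have hr : HasDerivAt (fun t : ℝ => t ^ (k - 1)) ((k - 1) * x ^ (k - 1 - 1)) x :=
    Real.hasDerivAt_rpow_const (Or.inl hx0.ne')
  have hH : HasDerivAt (Hfun p Λ₀ γ η k)
      (p * ((k - 1) * x ^ (k - 1 - 1)) * (1 - (1 + η) * x / Λ₀)
        + (1 + p * x ^ (k - 1)) * (-((1 + η) * 1 / Λ₀))) x := by
    unfold Hfun
    exact (((hr.const_mul p).const_add 1).mul
      ((((hasDerivAt_id' x).const_mul (1 + η)).div_const Λ₀).const_sub 1)).sub_const _
  rw [hH.deriv]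
  unfold Hfun at hHx
  have hfst : HasFDerivAt (fun q : ℝ × ℝ => q.1) (ContinuousLinearMap.fst ℝ ℝ ℝ) (x, η * x) :=
    hasFDerivAt_fst
  have hsnd : HasFDerivAt (fun q : ℝ × ℝ => q.2) (ContinuousLinearMap.snd ℝ ℝ ℝ) (x, η * x) :=
    hasFDerivAt_snd
  have hr2 : HasFDerivAt (fun q : ℝ × ℝ => q.1 ^ (k - 1))
      (((k - 1) * x ^ (k - 1 - 1)) • ContinuousLinearMap.fst ℝ ℝ ℝ) (x, η * x) :=
    HasDerivAt.comp_hasFDerivAt (h₂ := fun t : ℝ => t ^ (k - 1)) (x, η * x) hr hfst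
  have hF := (((hfst.mul ((hr2.const_mul p).const_add 1)).mul
    ((hfst.const_sub Λ₀).sub hsnd)).sub (hfst.const_mul γ)).prodMk ((hfst.const_mul η).sub hsnd)
  generalize (k - 1) * x ^ (k - 1 - 1) = d at *
  generalize hrr : x ^ (k - 1) = r at *
  have hE : (1 + p * r) * (Λ₀ - x - η * x) = γ := by
    field_simp at hHx
    linarith
  have hdet : Matrix.det !![x * (p * d) * (Λ₀ - x - η * x) - x * (1 + p * r), -(x * (1 + p * r));
      η, -1] = -Λ₀ * x * (p * d * (1 - (1 + η) * x / Λ₀)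
        + (1 + p * r) * (-((1 + η) * 1 / Λ₀))) := by
    rw [Matrix.det_fin_two_of]
    field_simp
    ring
  refine ⟨x * (p * d) * (Λ₀ - x - η * x) - x * (1 + p * r), -(x * (1 + p * r)), ?_, hdet, ?_⟩
  · refine HasFDerivAt.congr_fderiv (f := starVF p Λ₀ γ η k) hF ?_
    unfold clm2
    ext <;> simp [hrr]
    · linear_combination hE
  · intro hpos
    have hneg : Matrix.det !![x * (p * d) * (Λ₀ - x - η * x) - x * (1 + p * r),
        -(x * (1 + p * r)); η, -1] < 0 := by
      rw [hdet]
      have := mul_pos (mul_pos hΛ hx0) hpos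
      linarith
    refine ⟨hneg, ?_⟩
    rw [Matrix.det_fin_two_of] at hneg
    generalize x * (p * d) * (Λ₀ - x - η * x) - x * (1 + p * r) = a at *
    generalize -(x * (1 + p * r)) = b at *
    have hD : (a - 1) ^ 2 < (a - 1) ^ 2 - 4 * (a * -1 - b * η) := by linarith
    have hs := Real.sq_sqrt ((sq_nonneg (a - 1)).trans hD.le)
    have hs0 := Real.sqrt_nonneg ((a - 1) ^ 2 - 4 * (a * -1 - b * η))
    generalize Real.sqrt ((a - 1) ^ 2 - 4 * (a * -1 - b * η)) = s at *
    have habs : |a - 1| < s := by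
      apply abs_lt_of_sq_lt_sq _ hs0
      linarith
    obtain ⟨h1, h2⟩ := abs_lt.mp habs
    refine ⟨(a - 1 + s) / 2, (a - 1 - s) / 2, by linarith, by linarith,
      eig_aux a b η _ hη ?_, eig_aux a b η _ hη ?_⟩
    · linear_combination hs / 4
    · linear_combination hs / 4
end

section
/- Let k > 1, z > 0, p > 0, η > 0, and set Λ₀ = (1+η)·(z + k·p·z^k)/(p·(k−1)·z^(k−1)) and γ = (1+η)·(z + p·z^k)²/(p·(k−1)·z^k); assume γ > η. Then: (a) z ∈ (0, Λ₀/(1+η)) and H(z) = 0 = H'(z), so (z, η·z) is a positive equilibrium of system (★) at which H has a double zero; (b) the Jacobian matrix of the vector field of (★) at (z, η·z) equals [[η·(z + p·z^k), −(z + p·z^k)], [η, −1]], its determinant is 0 and its trace is η·(z + p·z^k) − 1, so 0 is an eigenvalue; (c) both eigenvalues of this matrix are 0 if and only if η = 1/(z + p·z^k). -/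
lemma eig_iff_aux (S η μ : ℝ) :
    Module.End.HasEigenvalue (Matrix.toLin' !![η * S, -S; η, -1]) μ ↔
      ∃ a b : ℝ, (a ≠ 0 ∨ b ≠ 0) ∧ η * S * a - S * b = μ * a ∧ η * a - b = μ * b := by
  constructor
  · intro h
    obtain ⟨v, hv⟩ := h.exists_hasEigenvector
    have h1 := hv.apply_eq_smul
    have h2 := hv.2
    refine ⟨v 0, v 1, ?_, ?_, ?_⟩
    · by_contra hc
      push Not at hc
      apply h2
      ext i
      fin_cases i
      · exact hc.1
      · exact hc.2
    · have := congrFun h1 0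
      simp [Matrix.toLin'_apply, Matrix.mulVec, dotProduct, Fin.sum_univ_two] at this
      linarith
    · have := congrFun h1 1
      simp [Matrix.toLin'_apply, Matrix.mulVec, dotProduct, Fin.sum_univ_two] at this
      linarith
  · rintro ⟨a, b, hab, h1, h2⟩
    apply Module.End.hasEigenvalue_of_hasEigenvector (x := ![a, b])
    refine ⟨?_, ?_⟩
    · rw [Module.End.mem_eigenspace_iff]
      ext i
      fin_cases i
      · simp [Matrix.toLin'_apply, Matrix.mulVec, dotProduct, Fin.sum_univ_two]
        linarith
      · simp [Matrix.toLin'_apply, Matrix.mulVec, dotProduct, Fin.sum_univ_two]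
        linarith
    · intro h0
      have e0 := congrFun h0 0
      have e1 := congrFun h0 1
      simp at e0 e1
      rcases hab with h | h
      · exact h e0
      · exact h e1

/-- At the degenerate parameter values
`Λ₀ = (1+η)(z+kpz^k)/(p(k−1)z^(k−1))`, `γ = (1+η)(z+pz^k)²/(p(k−1)z^k)` (with `γ > η`),
the point `(z, ηz)` is a positive equilibrium at which `H` has a double zero; the Jacobian
there is `[[η(z+pz^k), −(z+pz^k)], [η, −1]]` with determinant `0` and trace `η(z+pz^k)−1`,
so `0` is an eigenvalue; both eigenvalues vanish iff `η = 1/(z+pz^k)`. -/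
theorem degenerate_equilibrium_nilpotent_conditions
    (p η k z Λ₀ γ : ℝ)
    (hp : 0 < p) (hη : 0 < η) (hz : 0 < z) (hk : 1 < k)
    (hΛ : Λ₀ = (1 + η) * (z + k * p * z ^ k) / (p * (k - 1) * z ^ (k - 1)))
    (hγ : γ = (1 + η) * (z + p * z ^ k) ^ 2 / (p * (k - 1) * z ^ k))
    (hγη : η < γ) :
    (z ∈ Set.Ioo (0 : ℝ) (Λ₀ / (1 + η)) ∧
      Hfun p Λ₀ γ η k z = 0 ∧ deriv (Hfun p Λ₀ γ η k) z = 0 ∧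
      starVF p Λ₀ γ η k (z, η * z) = (0, 0)) ∧
    (HasFDerivAt (starVF p Λ₀ γ η k)
        (clm2 (η * (z + p * z ^ k)) (-(z + p * z ^ k)) η (-1)) (z, η * z) ∧
      Matrix.det !![η * (z + p * z ^ k), -(z + p * z ^ k); η, -1] = 0 ∧
      Matrix.trace !![η * (z + p * z ^ k), -(z + p * z ^ k); η, -1]
        = η * (z + p * z ^ k) - 1 ∧
      Module.End.HasEigenvalue
        (Matrix.toLin' !![η * (z + p * z ^ k), -(z + p * z ^ k); η, -1]) 0) ∧
    ((∀ μ : ℝ, Module.End.HasEigenvalue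
        (Matrix.toLin' !![η * (z + p * z ^ k), -(z + p * z ^ k); η, -1]) μ → μ = 0) ↔
      η = 1 / (z + p * z ^ k)) := by
  have hw : 0 < z ^ (k - 1) := Real.rpow_pos_of_pos hz _
  have hzk : z ^ k = z * z ^ (k - 1) := by
    rw [Real.rpow_sub_one hz.ne']
    field_simp
  have hpow : HasDerivAt (fun x : ℝ => x ^ (k - 1)) ((k - 1) * (z ^ (k - 1) / z)) z := by
    have := Real.hasDerivAt_rpow_const (x := z) (p := k - 1) (Or.inl hz.ne')
    rwa [Real.rpow_sub_one hz.ne'] at this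
  rw [hzk] at hΛ hγ ⊢
  generalize hwd : z ^ (k - 1) = w at *
  have hk1 : 0 < k - 1 := by linarith
  have hη1 : 0 < 1 + η := by linarith
  have hS : 0 < z + p * (z * w) := by positivity
  have hA : 0 < 1 + k * p * w := by
    have : 0 < k := by linarith
    positivity
  have hden : 0 < p * (k - 1) * w := by positivity
  have hΛ' : Λ₀ * (p * (k - 1) * w) = (1 + η) * (z * (1 + k * p * w)) := by
    rw [hΛ]; field_simp
  have hL : p * (k - 1) * w * (Λ₀ - z - η * z) = (1 + η) * z * (1 + p * w) := by
    linear_combination hΛ'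
  have hγ' : γ = (1 + p * w) * (Λ₀ - z - η * z) := by
    have h1 : γ * (p * (k - 1) * w) = (1 + η) * z * (1 + p * w) ^ 2 := by
      rw [hγ]; field_simp
    apply mul_right_cancel₀ hden.ne'
    linear_combination h1 - (1 + p * w) * hL
  have hLpos : 0 < Λ₀ - z - η * z := by
    have : 0 < p * (k - 1) * w * (Λ₀ - z - η * z) := by rw [hL]; positivity
    exact pos_of_mul_pos_right this hden.le
  have hΛpos : 0 < Λ₀ := by nlinarith [mul_pos hη hz]
  have hev := eig_iff_aux (z + p * (z * w)) η
  refine ⟨⟨⟨hz, ?_⟩, ?_, ?_, ?_⟩, ⟨?_, ?_, ?_, ?_⟩, ?_⟩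
  · rw [lt_div_iff₀ hη1]; linarith
  · unfold Hfun
    rw [hwd, hγ']
    field_simp
    ring
  · have h1 : HasDerivAt (Hfun p Λ₀ γ η k)
        ((p * ((k - 1) * (w / z))) * (1 - (1 + η) * z / Λ₀)
          + (1 + p * z ^ (k - 1)) * (-((1 + η) * 1 / Λ₀))) z := by
      unfold Hfun
      exact (((hpow.const_mul p).const_add 1).mul
        ((((hasDerivAt_id z).const_mul (1 + η)).div_const Λ₀).const_sub 1)).sub_const _
    rw [h1.deriv, hwd]
    field_simp
    linear_combination hL
  · unfold starVF
    simp only [hwd, hγ', Prod.mk.injEq]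
    constructor <;> ring
  · have hg : HasDerivAt (fun x : ℝ => x * (1 + p * x ^ (k - 1)))
        (1 * (1 + p * z ^ (k - 1)) + z * (p * ((k - 1) * (w / z)))) z :=
      (hasDerivAt_id z).mul ((hpow.const_mul p).const_add 1)
    have hf1 : HasFDerivAt (fun q : ℝ × ℝ => q.1) (ContinuousLinearMap.fst ℝ ℝ ℝ) (z, η * z) :=
      hasFDerivAt_fst
    have hf2 : HasFDerivAt (fun q : ℝ × ℝ => q.2) (ContinuousLinearMap.snd ℝ ℝ ℝ) (z, η * z) :=
      hasFDerivAt_snd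
    have hg' := HasDerivAt.comp_hasFDerivAt (f := fun q : ℝ × ℝ => q.1) (z, η * z) hg hf1
    have h1 := (hg'.mul ((hf1.const_sub Λ₀).sub hf2)).sub (hf1.const_mul γ)
    have h2 := (hf1.const_mul η).sub hf2
    have h3 := h1.prodMk h2
    unfold starVF
    refine h3.congr_fderiv ?_
    have hd : z * (p * ((k - 1) * (w / z))) = p * (k - 1) * w := by field_simp
    rw [hd, hwd]
    refine ContinuousLinearMap.ext fun v => ?_
    obtain ⟨a, b⟩ := v
    simp [clm2, hwd]
    constructor
    · linear_combination a * hL - a * hγ'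
    · ring
  · rw [Matrix.det_fin_two_of]; ring
  · rw [Matrix.trace_fin_two_of]; ring
  · rw [hev]
    exact ⟨1, η, Or.inl one_ne_zero, by ring, by ring⟩
  · rw [eq_div_iff hS.ne']
    constructor
    · intro h
      have := h (η * (z + p * (z * w)) - 1)
        ((hev _).2 ⟨z + p * (z * w), 1, Or.inr one_ne_zero, by ring, by ring⟩)
      linarith
    · intro h μ hμ
      obtain ⟨a, b, hab, h1, h2⟩ := (hev μ).1 hμ
      generalize z + p * (z * w) = S at *
      have ha : μ ^ 2 * a = 0 := by
        linear_combination (-μ - η * S) * h1 + S * h2 + (η * S * a - S * b) * h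
      have hb : μ ^ 2 * b = 0 := by
        linear_combination (-μ) * h2 - η * h1 + h2 + (η * a - b) * h
      rcases hab with h' | h'
      · simpa [h'] using ha
      · simpa [h'] using hb
end

section
/- Let k > 1, z > 0, p > 0, η > 0, and set Λ₀ = (1 + z + p·z^k·(k − η + k·η))/(p·z^(k−1)·(k−1)) and γ = (z·(z+1) + p·z^k·(p·z^k + 1) + 2·p·z^(k+1))/(p·z^k·(k−1)); assume Λ₀ > 0, γ > η and z < Λ₀/(1+η). Then H(z) = 0, so (z, η·z) is a positive equilibrium of system (★); the Jacobian matrix of the vector field of (★) at (z, η·z) has trace 0 and determinant p·η·z^k + η·z − 1. In particular this determinant is positive if and only if η > 1/(z + p·z^k). -/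
/-- At the Hopf parameter values
`Λ₀ = (1+z+pz^k(k−η+kη))/(pz^(k−1)(k−1))`,
`γ = (z(z+1)+pz^k(pz^k+1)+2pz^(k+1))/(pz^k(k−1))`, the point `(z, ηz)` is a positive
equilibrium of (★); the Jacobian there has trace `0` and determinant `pηz^k+ηz−1`, which is
positive iff `η > 1/(z+pz^k)`. -/
theorem hopf_trace_zero_conditions
    (p η k z Λ₀ γ : ℝ)
    (hp : 0 < p) (hη : 0 < η) (hz : 0 < z) (hk : 1 < k)
    (hΛdef : Λ₀ = (1 + z + p * z ^ k * (k - η + k * η)) / (p * z ^ (k - 1) * (k - 1)))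
    (hγdef : γ = (z * (z + 1) + p * z ^ k * (p * z ^ k + 1) + 2 * p * z ^ (k + 1))
      / (p * z ^ k * (k - 1)))
    (hΛ : 0 < Λ₀) (hγη : η < γ) (hzlt : z < Λ₀ / (1 + η)) :
    Hfun p Λ₀ γ η k z = 0 ∧
    starVF p Λ₀ γ η k (z, η * z) = (0, 0) ∧
    ∃ a b : ℝ,
      HasFDerivAt (starVF p Λ₀ γ η k) (clm2 a b η (-1)) (z, η * z) ∧
      Matrix.trace !![a, b; η, -1] = 0 ∧
      Matrix.det !![a, b; η, -1] = p * η * z ^ k + η * z - 1 ∧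
      (0 < Matrix.det !![a, b; η, -1] ↔ 1 / (z + p * z ^ k) < η) := by
  have hw : 0 < z ^ (k - 1) := Real.rpow_pos_of_pos hz _
  have e1 : z ^ k = z * z ^ (k - 1) := by
    have h := Real.rpow_add hz 1 (k - 1)
    rw [Real.rpow_one] at h
    rw [← h]; congr 1; ring
  have e2 : z ^ (k + 1) = z * z * z ^ (k - 1) := by
    rw [Real.rpow_add hz, Real.rpow_one, e1]; ring
  have e3 : z ^ (k - 1 - 1) * z = z ^ (k - 1) := by
    have h := Real.rpow_add hz (k - 1 - 1) 1
    rw [Real.rpow_one] at h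
    rw [← h]; congr 1; ring
  have hpow : HasDerivAt (fun x : ℝ => x ^ (k - 1)) ((k - 1) * z ^ (k - 1 - 1)) z :=
    Real.hasDerivAt_rpow_const (Or.inl hz.ne')
  rw [e2, e1] at hγdef
  rw [e1] at hΛdef
  rw [e1]
  generalize z ^ (k - 1 - 1) = v at *
  generalize hwd : z ^ (k - 1) = w at *
  have hk1 : k - 1 ≠ 0 := by linarith
  have hS : (Λ₀ - z - η * z) * (p * w * (k - 1)) = 1 + z + p * z * w := by
    rw [hΛdef]; field_simp; ring
  have hγ : γ = (1 + p * w) * (Λ₀ - z - η * z) := by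
    rw [hγdef, hΛdef]; field_simp; ring
  have hdet : Matrix.det !![1, -(z + p * (z * w)); η, -1] = p * η * (z * w) + η * z - 1 := by
    rw [Matrix.det_fin_two_of]; ring
  refine ⟨?_, ?_, 1, -(z + p * (z * w)), ?_, ?_, hdet, ?_⟩
  · unfold Hfun
    rw [hwd, hγ]; field_simp; ring
  · unfold starVF
    simp only [hwd, Prod.mk.injEq]
    refine ⟨?_, by ring⟩
    rw [hγ]; ring
  · have h1 : HasFDerivAt (fun q : ℝ × ℝ => q.1) (ContinuousLinearMap.fst ℝ ℝ ℝ) (z, η * z) :=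
      hasFDerivAt_fst
    have h2 : HasFDerivAt (fun q : ℝ × ℝ => q.2) (ContinuousLinearMap.snd ℝ ℝ ℝ) (z, η * z) :=
      hasFDerivAt_snd
    have h3 : HasFDerivAt (fun q : ℝ × ℝ => q.1 ^ (k - 1))
        (((k - 1) * v) • ContinuousLinearMap.fst ℝ ℝ ℝ) (z, η * z) :=
      HasDerivAt.comp_hasFDerivAt (z, η * z) (f := fun q : ℝ × ℝ => q.1) hpow h1
    have h4 := ((h1.mul ((h3.const_mul p).const_add 1)).mul ((h1.const_sub Λ₀).sub h2)).sub
      (h1.const_mul γ)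
    have h5 := (h1.const_mul η).sub h2
    refine (h4.prodMk h5).congr_fderiv ?_
    have key : z * (p * ((k - 1) * v)) * (Λ₀ - z - η * z) = 1 + z + p * z * w := by
      rw [← hS, ← e3]; ring
    apply ContinuousLinearMap.ext
    rintro ⟨s, t⟩
    simp [clm2, hwd]
    refine ⟨?_, by ring⟩
    rw [hγ]
    linear_combination s * key
  · simp [Matrix.trace_fin_two]
  · rw [hdet, div_lt_iff₀ (by positivity)]
    constructor <;> intro h <;> nlinarith
end

section
/- For real z > 0 and η > 0, define Δ̃*(z, η) = z²·(η²·z² + 4·η·z² + 4·z² − 4·η²·z − 6·η·z + 4·z + 9). Then: (a) if 0 < z < 4 and 0 < η < (2z − 3)/(4 − z) + 2·√(9 + 4z)/((4 − z)·√z), then Δ̃*(z, η) > 0; (b) if z > 4, then Δ̃*(z, η) > 0 for every η > 0; (c) if 0 < z < 4 and η > (2z − 3)/(4 − z) + 2·√(9 + 4z)/((4 − z)·√z), then Δ̃*(z, η) < 0. -/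
/-- Sign of the discriminant
`Δ̃*(z,η) = z²(η²z² + 4ηz² + 4z² − 4η²z − 6ηz + 4z + 9)` arising in the Hopf analysis for
`k = 2`. -/
theorem discriminant_sign
    (z η : ℝ) (hz : 0 < z) (hη : 0 < η) :
    (z < 4 → η < (2 * z - 3) / (4 - z) + 2 * Real.sqrt (9 + 4 * z) / ((4 - z) * Real.sqrt z) →
      0 < z ^ 2 * (η ^ 2 * z ^ 2 + 4 * η * z ^ 2 + 4 * z ^ 2
        - 4 * η ^ 2 * z - 6 * η * z + 4 * z + 9)) ∧
    (4 < z →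
      0 < z ^ 2 * (η ^ 2 * z ^ 2 + 4 * η * z ^ 2 + 4 * z ^ 2
        - 4 * η ^ 2 * z - 6 * η * z + 4 * z + 9)) ∧
    (z < 4 → (2 * z - 3) / (4 - z) + 2 * Real.sqrt (9 + 4 * z) / ((4 - z) * Real.sqrt z) < η →
      z ^ 2 * (η ^ 2 * z ^ 2 + 4 * η * z ^ 2 + 4 * z ^ 2
        - 4 * η ^ 2 * z - 6 * η * z + 4 * z + 9) < 0) := by
  have hs : 0 < Real.sqrt z := Real.sqrt_pos.mpr hz
  have hb : 0 < Real.sqrt (9 + 4 * z) := Real.sqrt_pos.mpr (by linarith)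
  have hs2 : Real.sqrt z ^ 2 = z := Real.sq_sqrt hz.le
  have hb2 : Real.sqrt (9 + 4 * z) ^ 2 = 9 + 4 * z := Real.sq_sqrt (by linarith)
  generalize Real.sqrt z = s at *
  generalize Real.sqrt (9 + 4 * z) = b at *
  -- completing the square in η
  have key : (4 - z) * (η ^ 2 * z ^ 2 + 4 * η * z ^ 2 + 4 * z ^ 2
        - 4 * η ^ 2 * z - 6 * η * z + 4 * z + 9) =
      (2 * b - s * ((4 - z) * η - (2 * z - 3))) * (2 * b + s * ((4 - z) * η - (2 * z - 3))) := by
    linear_combination (-4) * hb2 + ((4 - z) * η - (2 * z - 3)) ^ 2 * hs2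
  have hthr : z < 4 → (2 * z - 3) / (4 - z) + 2 * b / ((4 - z) * s) =
      ((2 * z - 3) * s + 2 * b) / ((4 - z) * s) := by
    intro h
    have h4 : 4 - z ≠ 0 := by linarith
    field_simp
  refine ⟨fun h hlt => ?_, fun h => ?_, fun h hlt => ?_⟩
  · have h4 : 0 < 4 - z := by linarith
    rw [hthr h, lt_div_iff₀ (by positivity)] at hlt
    refine mul_pos (by positivity) ?_
    rcases le_total 0 ((4 - z) * η - (2 * z - 3)) with hw | hw
    · refine pos_of_mul_pos_right (a := 4 - z) ?_ h4.le
      rw [key]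
      have := mul_nonneg hs.le hw
      exact mul_pos (by linarith) (by linarith)
    · have h1 : 0 < (4 - z) * η := mul_pos h4 hη
      have h2 : 0 < z * η * (2 * (2 * z - 3) - (4 - z) * η) :=
        mul_pos (mul_pos hz hη) (by linarith)
      nlinarith [sq_nonneg z]
  · refine mul_pos (by positivity) ?_
    have h1 : 0 < z * η ^ 2 * (z - 4) := mul_pos (by positivity) (by linarith)
    have h2 : 0 < z * η * (4 * z - 6) := mul_pos (by positivity) (by linarith)
    nlinarith [sq_nonneg z]
  · have h4 : 0 < 4 - z := by linarith
    rw [hthr h, div_lt_iff₀ (by positivity)] at hlt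
    refine mul_neg_of_pos_of_neg (by positivity) ?_
    refine neg_of_mul_neg_right (a := 4 - z) ?_ h4.le
    rw [key]
    exact mul_neg_of_neg_of_pos (by linarith) (by linarith)
end
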